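/- arXiv:1303.0486 — 3 statements merged into one kernel-verified Lean document; each statement's English description precedes it below -/
import Mathlib

section
/- Let n ≥ 1 and r ≥ 0 be integers, and let J be an almost complex structure on ℝ^{2n} with J(0) equal to the standard complex structure i. Then there exists an open neighbourhood V of 0 in ℝ^{2n} such that for every z₀ ∈ ℂ, every p ∈ V, and all vectors a₁, …, a_r ∈ ℝ^{2n}, there exist ε > 0 and a J-holomorphic map u from the open disc of radius ε about z₀ into ℝ^{2n} satisfying u(z₀) = p and ∂_x^ℓ u(z₀) = a_ℓ for all ℓ = 1, …, r. -/
-- We model `ℝ^{2n}` as `ℂ^n = Fin n → ℂ`.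
/-- Partial derivative in the `x`-direction. -/
noncomputable def pX {E : Type*} [NormedAddCommGroup E] [NormedSpace ℝ E]
    (u : ℂ → E) : ℂ → E := fun z => fderiv ℝ u z 1

/-- Partial derivative in the `y`-direction. -/
noncomputable def pY {E : Type*} [NormedAddCommGroup E] [NormedSpace ℝ E]
    (u : ℂ → E) : ℂ → E := fun z => fderiv ℝ u z Complex.I

/-- The standard complex structure `i` on `ℝ^{2n} ≅ ℂ^n`, i.e. componentwise
multiplication by `i`. -/
noncomputable def Jstd (n : ℕ) : (Fin n → ℂ) →L[ℝ] (Fin n → ℂ) :=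
  Complex.I • ContinuousLinearMap.id ℝ (Fin n → ℂ)

open Set Filter Topology MeasureTheory
open scoped ContDiff

section Superposition

universe v
/-- Pointwise application of a continuous family of operators to a continuous family of vectors,
as a continuous bilinear map. -/
noncomputable def pointwiseApply (K : Type*) [TopologicalSpace K] [CompactSpace K] (A B : Type*)
    [NormedAddCommGroup A] [NormedSpace ℝ A] [NormedAddCommGroup B] [NormedSpace ℝ B] :
    C(K, A →L[ℝ] B) →L[ℝ] C(K, A) →L[ℝ] C(K, B) :=
  LinearMap.mkContinuous₂
    (LinearMap.mk₂ ℝ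
      (fun (L : C(K, A →L[ℝ] B)) (V : C(K, A)) =>
        (⟨fun z => L z (V z), L.continuous.clm_apply V.continuous⟩ : C(K, B)))
      (fun _ _ _ => by ext; simp) (fun _ _ _ => by ext; simp)
      (fun _ _ _ => by ext; simp) (fun _ _ _ => by ext; simp)) 1
    (fun L V => by
      rw [ContinuousMap.norm_le _ (by positivity)]
      intro z
      rw [one_mul]
      refine ((L z).le_opNorm _).trans ?_
      gcongr
      exacts [L.norm_coe_le_norm z, V.norm_coe_le_norm z])

variable {K : Type*} [TopologicalSpace K] [CompactSpace K]

@[simp]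
theorem pointwiseApply_apply {A B : Type*}
    [NormedAddCommGroup A] [NormedSpace ℝ A] [NormedAddCommGroup B] [NormedSpace ℝ B]
    (L : C(K, A →L[ℝ] B)) (V : C(K, A)) (z : K) : pointwiseApply K A B L V z = L z (V z) := rfl

/-- The superposition operator `U ↦ F ∘ U` is differentiable on `C(K, A)` if `F` is `C¹`. -/
theorem hasFDerivAt_superposition {A B : Type*}
    [NormedAddCommGroup A] [NormedSpace ℝ A] [NormedAddCommGroup B] [NormedSpace ℝ B]
    (F : C(A, B)) (F' : C(A, A →L[ℝ] B)) (hF : ∀ a, HasFDerivAt F (F' a) a) (U : C(K, A)) :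
    HasFDerivAt (fun U : C(K, A) => F.comp U) (pointwiseApply K A B (F'.comp U)) U := by
  rw [hasFDerivAt_iff_isLittleO, Asymptotics.isLittleO_iff]
  intro ε hε
  obtain ⟨δ, hδ, hball⟩ : ∃ δ > 0, ∀ {V : C(K, A)}, dist V U < δ →
      dist (F'.comp V) (F'.comp U) < ε :=
    Metric.continuousAt_iff.1 (F'.continuous_postcomp (X := K)).continuousAt ε hε
  filter_upwards [Metric.ball_mem_nhds U hδ] with V hV
  rw [ContinuousMap.norm_le _ (by positivity)]
  intro z
  have hseg : ∀ w ∈ segment ℝ (U z) (V z), ‖F' w - F' (U z)‖ ≤ ε := by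
    intro w hw
    rw [segment_eq_image'] at hw
    obtain ⟨t, ht, rfl⟩ := hw
    have hmem : dist (U + t • (V - U)) U < δ := by
      rw [dist_eq_norm, add_sub_cancel_left, norm_smul, Real.norm_of_nonneg ht.1]
      calc t * ‖V - U‖ ≤ 1 * ‖V - U‖ := by gcongr; exact ht.2
        _ < δ := by rw [one_mul, ← dist_eq_norm]; exact hV
    have h2 := (ContinuousMap.dist_apply_le_dist z).trans (hball hmem).le
    rw [dist_eq_norm] at h2
    simpa using h2
  have := (convex_segment (U z) (V z)).norm_image_sub_le_of_norm_hasFDerivWithin_le'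
    (fun w _ => (hF w).hasFDerivWithinAt) hseg (left_mem_segment ℝ _ _) (right_mem_segment ℝ _ _)
  refine this.trans ?_
  gcongr
  exact (V - U).norm_coe_le_norm z

theorem contDiff_superposition_nat {A : Type v} [NormedAddCommGroup A] [NormedSpace ℝ A] (n : ℕ) :
    ∀ {B : Type v} [NormedAddCommGroup B] [NormedSpace ℝ B] (F : C(A, B)), ContDiff ℝ n F →
      ContDiff ℝ n (fun U : C(K, A) => F.comp U) := by
  induction n with
  | zero =>
    intro B _ _ F _
    exact contDiff_zero.2 F.continuous_postcomp
  | succ n ih =>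
    intro B _ _ F hF
    have hF' : ContDiff ℝ n (fderiv ℝ F) := hF.fderiv_right (by norm_cast)
    refine contDiff_succ_iff_hasFDerivAt.2
      ⟨fun U => pointwiseApply K A B ((⟨fderiv ℝ F, hF'.continuous⟩ : C(A, A →L[ℝ] B)).comp U),
      ContDiff.comp (g := pointwiseApply K A B) (ContinuousLinearMap.contDiff _) (ih ⟨fderiv ℝ F, hF'.continuous⟩ hF'), fun U => ?_⟩
    exact hasFDerivAt_superposition F _
      (fun a => (hF.differentiable (by simp) a).hasFDerivAt) U

/-- The superposition operator of a smooth map is smooth on `C(K, A)`. -/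
theorem contDiff_superposition {A B : Type v} [NormedAddCommGroup A] [NormedSpace ℝ A]
    [NormedAddCommGroup B] [NormedSpace ℝ B] (F : C(A, B)) (hF : ContDiff ℝ ∞ F) :
    ContDiff ℝ ∞ (fun U : C(K, A) => F.comp U) :=
  contDiff_infty.2 fun n => contDiff_superposition_nat n F (hF.of_le (mod_cast le_top))

end Superposition

section Implicit

variable {A B : Type*} [NormedAddCommGroup A] [NormedSpace ℝ A] [CompleteSpace A]
  [NormedAddCommGroup B] [NormedSpace ℝ B] [CompleteSpace B]

/-- A version of the implicit function theorem in which the implicit function is smooth on a whole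
neighbourhood of the base point. -/
theorem exists_smooth_implicit (G : A × B → B) (hG : ContDiff ℝ ∞ G) (a₀ : A) (b₀ : B)
    (h0 : G (a₀, b₀) = 0) (hinv : (fderiv ℝ G (a₀, b₀) ∘L .inr ℝ A B).IsInvertible) :
    ∃ ψ : A → B, ψ a₀ = b₀ ∧ (∀ᶠ a in 𝓝 a₀, ContDiffAt ℝ ∞ ψ a ∧ G (a, ψ a) = 0) ∧
      ∀ᶠ v in 𝓝 (a₀, b₀), G v = 0 → ψ v.1 = v.2 := by
  have hn : (∞ : ℕ∞ω) ≠ 0 := by simp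
  have key : ∀ v : A × B, G v = 0 → (fderiv ℝ G v ∘L .inr ℝ A B).IsInvertible →
      ∃ ψ : A → B, ψ v.1 = v.2 ∧ ContDiffAt ℝ ∞ ψ v.1 ∧ (∀ᶠ a in 𝓝 v.1, G (a, ψ a) = 0) ∧
      ∀ᶠ w in 𝓝 v, G w = 0 → ψ w.1 = w.2 := by
    intro v hv hi
    have hc : ContDiffAt ℝ ∞ G v := hG.contDiffAt
    refine ⟨hc.implicitFunction hn hi, hc.implicitFunction_apply_self hn hi,
      hc.contDiffAt_implicitFunction hn hi, ?_, ?_⟩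
    · simpa only [hv] using hc.eventually_apply_implicitFunction hn hi
    · filter_upwards [hc.eventually_apply_eq_iff_implicitFunction hn hi] with w hw h
      exact hw.1 (h.trans hv.symm)
  obtain ⟨ψ, hψ0, hψs, hψG, hψu⟩ := key (a₀, b₀) h0 hinv
  refine ⟨ψ, hψ0, ?_, hψu⟩
  have hcψ : ContinuousAt ψ a₀ := hψs.continuousAt
  have hcont : ∀ᶠ a in 𝓝 a₀, ContinuousAt ψ a :=
    ((hψs.of_le (m := 1) (by simp)).eventually (by simp)).mono fun a ha => ha.continuousAt
  have hopen : ∀ᶠ v in 𝓝 (a₀, b₀), (fderiv ℝ G v ∘L .inr ℝ A B).IsInvertible := by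
    have hc : Continuous fun v => fderiv ℝ G v ∘L .inr ℝ A B :=
      (hG.continuous_fderiv hn).clm_comp continuous_const
    obtain ⟨e, he⟩ := hinv
    filter_upwards [hc.continuousAt.eventually (he ▸ e.nhds)] with v hv
    exact hv
  have hpair : Tendsto (fun a => (a, ψ a)) (𝓝 a₀) (𝓝 (a₀, b₀)) := by
    have := (continuousAt_id' a₀).prodMk hcψ
    simpa only [ContinuousAt, hψ0] using this
  filter_upwards [hcont, hpair.eventually hopen, hψG.eventually_nhds] with a hca hia hGa
  obtain ⟨ψ', -, h2, -, h4⟩ := key (a, ψ a) hGa.self_of_nhds hia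
  refine ⟨h2.congr_of_eventuallyEq ?_, hGa.self_of_nhds⟩
  have hpair' : Tendsto (fun a => (a, ψ a)) (𝓝 a) (𝓝 (a, ψ a)) :=
    (continuousAt_id (x := a)).prodMk hca
  filter_upwards [hGa, hpair'.eventually h4] with a' h1 h2
  exact (h2 h1).symm

end Implicit

section CauchyTransform

variable {E : Type*} [NormedAddCommGroup E] [NormedSpace ℝ E] [NormedSpace ℂ E]
  [IsScalarTower ℝ ℂ E]

/-- The Cauchy kernel `1 / (2πt)` of the operator `∂_x + i ∂_y`. -/
noncomputable def cauchyKernel (t : ℂ) : ℂ := (2 * Real.pi * t)⁻¹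

theorem measurable_cauchyKernel : Measurable cauchyKernel := by
  unfold cauchyKernel; fun_prop

theorem locallyIntegrable_cauchyKernel : LocallyIntegrable cauchyKernel := by
  have key : ∀ r, IntegrableOn cauchyKernel (Metric.ball 0 r) := by
    intro r
    refine integrableOn_ball_of_norm_le_rpow (C := (2 * Real.pi)⁻¹) (α := 1) (by simp) (by simp)
      (ae_of_all _ fun t => ?_) measurable_cauchyKernel.aestronglyMeasurable
    simp [cauchyKernel, abs_of_pos Real.pi_pos, Real.rpow_neg_one, mul_comm]
  intro z
  exact ⟨Metric.ball 0 (‖z‖ + 1), Metric.isOpen_ball.mem_nhds (by simp), key _⟩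

/-- The Cauchy transform, inverting `∂_x + i ∂_y` on compactly supported functions. -/
noncomputable def cauchyTransform (f : ℂ → E) : ℂ → E :=
  convolution cauchyKernel f (ContinuousLinearMap.lsmul ℝ ℂ) volume

theorem cauchyTransform_apply (f : ℂ → E) (z : ℂ) :
    cauchyTransform f z = ∫ t, cauchyKernel t • f (z - t) := rfl

theorem integrable_cauchyTransform {f : ℂ → E} (hf : Continuous f) (hs : HasCompactSupport f)
    (z : ℂ) : Integrable fun t => cauchyKernel t • f (z - t) :=
  hs.convolutionExists_right (ContinuousLinearMap.lsmul ℝ ℂ) locallyIntegrable_cauchyKernel hf z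

theorem continuous_cauchyTransform {f : ℂ → E} (hf : Continuous f) (hs : HasCompactSupport f) :
    Continuous (cauchyTransform f) :=
  hs.continuous_convolution_right _ locallyIntegrable_cauchyKernel hf

theorem cauchyTransform_add {f g : ℂ → E} (hf : Continuous f) (hs : HasCompactSupport f)
    (hg : Continuous g) (hsg : HasCompactSupport g) :
    cauchyTransform (f + g) = cauchyTransform f + cauchyTransform g := by
  ext z
  simp only [cauchyTransform_apply, Pi.add_apply, smul_add]
  exact integral_add (integrable_cauchyTransform hf hs z) (integrable_cauchyTransform hg hsg z)

theorem cauchyTransform_smul (r : ℝ) (f : ℂ → E) :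
    cauchyTransform (r • f) = r • cauchyTransform f := by
  have : SMulCommClass ℝ ℂ E := IsScalarTower.to_smulCommClass
  ext z
  simp only [cauchyTransform_apply, Pi.smul_apply, ← integral_smul, smul_comm r]

theorem norm_cauchyTransform_le {f : ℂ → E} {M r : ℝ} (hM : ∀ z, ‖f z‖ ≤ M) (hs : Function.support f ⊆ Metric.ball 0 r) {z : ℂ}
    (hz : z ∈ Metric.ball (0 : ℂ) r) :
    ‖cauchyTransform f z‖ ≤ (∫ t in Metric.ball 0 (2 * r), ‖cauchyKernel t‖) * M := by
  have hsup : ∀ t, t ∉ Metric.ball (0 : ℂ) (2 * r) → cauchyKernel t • f (z - t) = 0 := by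
    intro t ht
    suffices h : z - t ∉ Function.support f by rw [Function.notMem_support.1 h, smul_zero]
    refine fun h => ht ?_
    have h1 := hs h
    rw [mem_ball_zero_iff] at h1 hz ⊢
    calc ‖t‖ = ‖z - (z - t)‖ := by simp
      _ ≤ ‖z‖ + ‖z - t‖ := norm_sub_le _ _
      _ < 2 * r := by linarith
  rw [cauchyTransform_apply, ← setIntegral_eq_integral_of_forall_compl_eq_zero hsup,
    ← integral_mul_const]
  have hk : IntegrableOn cauchyKernel (Metric.ball 0 (2 * r)) :=
    (locallyIntegrable_cauchyKernel.integrableOn_isCompact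
      (isCompact_closedBall 0 (2 * r))).mono_set Metric.ball_subset_closedBall
  refine norm_integral_le_of_norm_le (hk.norm.mul_const M) (ae_of_all _ fun t => ?_)
  rw [norm_smul]
  gcongr
  exact hM _

/-- Behaviour of the Cauchy transform under complex dilations. -/
theorem cauchyTransform_dilation (f : ℂ → E) {c : ℂ} (hc : c ≠ 0) (z : ℂ) :
    cauchyTransform f (c * z) = (starRingEnd ℂ c) • cauchyTransform (fun w => f (c * w)) z := by
  have hdet : LinearMap.det (LinearMap.mul ℝ ℂ c) = Complex.normSq c := by
    rw [← Algebra.norm_complex_apply]; rfl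
  have hpos : 0 < Complex.normSq c := Complex.normSq_pos.2 hc
  have hmap := Measure.map_linearMap_addHaar_eq_smul_addHaar (volume : Measure ℂ)
    (f := LinearMap.mul ℝ ℂ c) (by rw [hdet]; exact hpos.ne')
  have hemb : MeasurableEmbedding (LinearMap.mul ℝ ℂ c) :=
    (Homeomorph.mulLeft₀ c hc).measurableEmbedding
  have h2 := hemb.integral_map (μ := volume) (fun t => cauchyKernel t • f (c * z - t))
  rw [hmap, hdet, integral_smul_measure, ENNReal.toReal_ofReal (abs_nonneg _),
    abs_of_pos (inv_pos.2 hpos), inv_smul_eq_iff₀ hpos.ne'] at h2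
  rw [cauchyTransform_apply, h2, cauchyTransform_apply, ← integral_smul, ← integral_smul]
  congr 1
  ext t
  have : c * z - c * t = c * (z - t) := by ring
  simp only [LinearMap.mul_apply', this, ← algebraMap_smul ℂ (Complex.normSq c), smul_smul]
  congr 1
  simp only [cauchyKernel, Complex.coe_algebraMap, Complex.normSq_eq_conj_mul_self]
  field_simp

end CauchyTransform

section CauchyPompeiu

variable {E : Type*} [NormedAddCommGroup E] [NormedSpace ℝ E] [NormedSpace ℂ E]
  [IsScalarTower ℝ ℂ E]

theorem integrableOn_polar_of_continuous {F : ℝ × ℝ → E} (hF : Continuous F) {R : ℝ}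
    (hR : ∀ r θ, R < r → F (r, θ) = 0) :
    IntegrableOn F (Ioi 0 ×ˢ Ioo (-Real.pi) Real.pi) := by
  have h : IntegrableOn F (Icc 0 R ×ˢ Icc (-Real.pi) Real.pi) :=
    hF.continuousOn.integrableOn_compact (isCompact_Icc.prod isCompact_Icc)
  refine h.of_forall_sdiff_eq_zero (measurableSet_Ioi.prod measurableSet_Ioo) ?_
  rintro ⟨r, θ⟩ ⟨⟨h1, h2⟩, h3⟩
  refine hR r θ (not_le.1 fun h4 => h3 ⟨⟨le_of_lt h1, h4⟩, Ioo_subset_Icc_self h2⟩)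

/-- The Cauchy–Pompeiu formula for compactly supported functions. -/
theorem integral_cauchyKernel_dbar {g : ℂ → E} (hg : ContDiff ℝ 1 g) (hs : HasCompactSupport g)
    [CompleteSpace E] (z : ℂ) :
    ∫ t, cauchyKernel t • (fderiv ℝ g (z - t) 1 + Complex.I • fderiv ℝ g (z - t) Complex.I)
      = g z := by
  set e : ℝ → ℂ := fun θ => Real.cos θ + Real.sin θ * Complex.I with he
  have hexp : e = fun θ : ℝ => Complex.exp (θ * Complex.I) := by
    ext θ
    rw [Complex.exp_mul_I, ← Complex.ofReal_cos, ← Complex.ofReal_sin]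
  have he1 : ∀ θ, ‖e θ‖ = 1 := fun θ => by rw [hexp]; exact Complex.norm_exp_ofReal_mul_I θ
  have hec : Continuous e := by rw [he]; fun_prop
  have hed : ∀ θ, HasDerivAt e (Complex.I * e θ) θ := by
    intro θ
    rw [hexp]
    simpa [mul_comm] using
      ((Complex.ofRealCLM.hasDerivAt (x := θ)).mul_const Complex.I).cexp
  have hdg : Continuous (fderiv ℝ g) := hg.continuous_fderiv (by simp)
  obtain ⟨R, hR⟩ : ∃ R : ℝ, ∀ r θ : ℝ, R < r → fderiv ℝ g (z - r * e θ) = 0 := by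
    obtain ⟨R, hR⟩ := (hs.fderiv (𝕜 := ℝ)).isCompact.isBounded.subset_closedBall 0
    refine ⟨R + ‖z‖, fun r θ h => ?_⟩
    by_contra h0
    have h1 := hR (subset_tsupport _ h0)
    rw [mem_closedBall_zero_iff] at h1
    have h2 : ‖(r : ℂ) * e θ‖ ≤ ‖z‖ + ‖z - r * e θ‖ := by
      simpa using norm_sub_le z (z - r * e θ)
    rw [norm_mul, he1, mul_one, Complex.norm_real, Real.norm_eq_abs] at h2
    linarith [le_abs_self r]
  set A₁ : ℝ × ℝ → E := fun p => fderiv ℝ g (z - p.1 * e p.2) (e p.2)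
  set A₂ : ℝ × ℝ → E := fun p => fderiv ℝ g (z - p.1 * e p.2) (Complex.I * e p.2)
  have hA₁ : Continuous A₁ := (hdg.comp (by fun_prop)).clm_apply (by fun_prop)
  have hA₂ : Continuous A₂ := (hdg.comp (by fun_prop)).clm_apply (by fun_prop)
  have hI₁ := integrableOn_polar_of_continuous hA₁ (R := R)
    (fun r θ h => by simp only [A₁, hR r θ h, zero_apply])
  have hI₂ := integrableOn_polar_of_continuous hA₂ (R := R)
    (fun r θ h => by simp only [A₂, hR r θ h, zero_apply])
  have hint₁ : ∫ p in Ioi (0 : ℝ) ×ˢ Ioo (-Real.pi) Real.pi, A₁ p = (2 * Real.pi) • g z := by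
    have hr : ∀ θ, ∫ r in Ioi (0 : ℝ), A₁ (r, θ) = g z := by
      intro θ
      have hiso : Isometry fun r : ℝ => z - r * e θ := by
        refine Isometry.of_dist_eq fun a b => ?_
        rw [dist_eq_norm, sub_sub_sub_cancel_left, ← sub_mul, norm_mul, he1, mul_one,
          ← Complex.ofReal_sub, Complex.norm_real, dist_eq_norm, norm_sub_rev]
      have hd : ∀ r : ℝ, HasDerivAt (fun r : ℝ => g (z - r * e θ)) (-A₁ (r, θ)) r := by
        intro r
        have h1 : HasDerivAt (fun r : ℝ => z - r * e θ) (-e θ) r := by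
          simpa using ((Complex.ofRealCLM.hasDerivAt (x := r)).mul_const (e θ)).const_sub z
        have h2 := ((hg.differentiable (by simp) _).hasFDerivAt (x := z - r * e θ)).comp_hasDerivAt
          r h1
        simpa [A₁, Function.comp_def] using h2
      have h1 := HasCompactSupport.integral_Ioi_deriv_eq (f := fun r : ℝ => g (z - r * e θ))
        (hg.comp (contDiff_const.sub (Complex.ofRealCLM.contDiff.mul contDiff_const))) (hs.comp_isClosedEmbedding hiso.isClosedEmbedding) 0
      simp_rw [fun r => (hd r).deriv, integral_neg] at h1
      simpa using h1
    have hI₁' := hI₁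
    rw [Measure.volume_eq_prod, IntegrableOn, ← Measure.prod_restrict] at hI₁'
    rw [Measure.volume_eq_prod, ← Measure.prod_restrict, integral_prod_symm _ hI₁']
    simp_rw [hr]
    rw [setIntegral_const]
    simp [Real.pi_pos.le, two_mul]
  have hint₂ : ∫ p in Ioi (0 : ℝ) ×ˢ Ioo (-Real.pi) Real.pi, A₂ p = 0 := by
    rw [Measure.volume_eq_prod, setIntegral_prod _ hI₂]
    refine setIntegral_eq_zero_of_forall_eq_zero fun r hr => ?_
    have hd : ∀ θ : ℝ, HasDerivAt (fun θ : ℝ => g (z - r * e θ)) (-(r • A₂ (r, θ))) θ := by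
      intro θ
      have h1 : HasDerivAt (fun θ : ℝ => z - r * e θ) (-(r • (Complex.I * e θ))) θ := by
        simpa using ((hed θ).const_mul (r : ℂ)).const_sub z
      have h2 := ((hg.differentiable (by simp) _).hasFDerivAt (x := z - r * e θ)).comp_hasDerivAt
        θ h1
      simpa only [map_neg, map_smul, A₂, Function.comp_def] using h2
    have h1 := intervalIntegral.integral_eq_sub_of_hasDerivAt (a := -Real.pi) (b := Real.pi)
      (fun θ _ => hd θ) (Continuous.intervalIntegrable (by fun_prop) _ _)
    rw [intervalIntegral.integral_neg, intervalIntegral.integral_smul] at h1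
    have h2 : e (-Real.pi) = e Real.pi := by simp [he]
    rw [h2, sub_self, neg_eq_zero, smul_eq_zero, or_iff_right (ne_of_gt hr),
      intervalIntegral.integral_of_le (by linarith [Real.pi_pos]), integral_Ioc_eq_integral_Ioo] at h1
    exact h1
  rw [← Complex.integral_comp_polarCoord_symm]
  have hcongr : ∀ p ∈ polarCoord.target, p.1 • cauchyKernel (Complex.polarCoord.symm p) •
      (fderiv ℝ g (z - Complex.polarCoord.symm p) 1 +
        Complex.I • fderiv ℝ g (z - Complex.polarCoord.symm p) Complex.I) =
      (2 * Real.pi)⁻¹ • (A₁ p + Complex.I • A₂ p) := by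
    rintro ⟨r, θ⟩ hp
    have hr : (r : ℂ) ≠ 0 := Complex.ofReal_ne_zero.2 (ne_of_gt hp.1)
    have hP : Complex.polarCoord.symm (r, θ) = r * e θ := Complex.polarCoord_symm_apply _
    have h1 : e θ * (Real.cos θ - Real.sin θ * Complex.I) = 1 := by
      have h := Complex.ofReal_inj.2 (Real.cos_sq_add_sin_sq θ)
      push_cast at h
      simp only [he]
      push_cast
      linear_combination h - Complex.sin θ ^ 2 * Complex.I_sq
    have he0 : e θ ≠ 0 := left_ne_zero_of_mul_eq_one h1
    have h2 : (r : ℂ) * cauchyKernel (r * e θ) =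
        (2 * Real.pi)⁻¹ * (Real.cos θ - Real.sin θ * Complex.I) := by
      rw [eq_inv_of_mul_eq_one_right h1, cauchyKernel]
      push_cast
      field_simp
    have h3 : e θ = Real.cos θ • (1 : ℂ) + Real.sin θ • Complex.I := by simp [he]
    have h4 : Complex.I * e θ = Real.cos θ • Complex.I - Real.sin θ • (1 : ℂ) := by
      simp only [he, Complex.real_smul]
      linear_combination Real.sin θ * Complex.I_sq
    simp only [hP, A₁, A₂]
    generalize fderiv ℝ g (z - r * e θ) = D
    rw [h4, congrArg D h3]
    simp only [map_add, map_sub, map_smul, ← algebraMap_smul ℂ (_ : ℝ) (_ : E),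
      Complex.coe_algebraMap]
    rw [smul_smul, h2]
    match_scalars <;> push_cast
    · linear_combination 0
    · linear_combination (-(2 * (Real.pi : ℂ))⁻¹ * Complex.sin θ) * Complex.I_sq
  rw [setIntegral_congr_fun polarCoord.open_target.measurableSet hcongr, integral_smul]
  rw [polarCoord_target, integral_add (g := fun p => Complex.I • A₂ p) hI₁ (hI₂.smul Complex.I), integral_smul, hint₁, hint₂, smul_zero,
    add_zero, smul_smul, inv_mul_cancel₀ (by positivity), one_smul]

end CauchyPompeiu

section CauchyTransformDbar

variable {E : Type*} [NormedAddCommGroup E] [NormedSpace ℝ E] [NormedSpace ℂ E]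
  [IsScalarTower ℝ ℂ E] [CompleteSpace E]

theorem dbar_cauchyTransform_of_contDiff {g : ℂ → E} (hg : ContDiff ℝ 1 g)
    (hs : HasCompactSupport g) (z : ℂ) :
    ∃ D : ℂ →L[ℝ] E, HasFDerivAt (cauchyTransform g) D z ∧
      D 1 + Complex.I • D Complex.I = g z := by
  have hdg : Continuous (fderiv ℝ g) := hg.continuous_fderiv (by simp)
  have hds : HasCompactSupport (fderiv ℝ g) := hs.fderiv (𝕜 := ℝ)
  refine ⟨_, hs.hasFDerivAt_convolution_right (ContinuousLinearMap.lsmul ℝ ℂ)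
    locallyIntegrable_cauchyKernel hg z, ?_⟩
  have happ : ∀ v : ℂ, HasCompactSupport fun a => fderiv ℝ g a v := fun v =>
    hds.comp_left (g := fun L : ℂ →L[ℝ] E => L v) (by simp)
  have hint : ∀ v : ℂ, Integrable fun t => cauchyKernel t • fderiv ℝ g (z - t) v := fun v =>
    integrable_cauchyTransform (f := fun a => fderiv ℝ g a v) (by fun_prop) (happ v) z
  rw [convolution_precompR_apply _ locallyIntegrable_cauchyKernel hds hdg,
    convolution_precompR_apply _ locallyIntegrable_cauchyKernel hds hdg,
    ← integral_cauchyKernel_dbar hg hs z]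
  simp_rw [smul_add, smul_comm _ Complex.I]
  rw [integral_add (g := fun t => Complex.I • cauchyKernel t • fderiv ℝ g (z - t) Complex.I)
    (hint 1) ((hint Complex.I).smul Complex.I), integral_smul]
  rfl

theorem hasDerivAt_cauchyTransform_of_eq_zero {f : ℂ → E} (hf : Continuous f)
    (hs : HasCompactSupport f) {w : ℂ} {δ : ℝ} (hδ : 0 < δ)
    (h0 : ∀ z ∈ Metric.ball w δ, f z = 0) : ∃ d, HasDerivAt (cauchyTransform f) d w := by
  have hswap : cauchyTransform f = fun z => ∫ t, cauchyKernel (z - t) • f t := by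
    ext z
    rw [cauchyTransform_apply, ← integral_sub_left_eq_self _ _ z]
    simp
  have hint : Integrable f := hf.integrable_of_hasCompactSupport hs
  have hmeas : ∀ z, AEStronglyMeasurable (fun t => cauchyKernel (z - t) • f t) := fun z =>
    (measurable_cauchyKernel.comp (by fun_prop)).aestronglyMeasurable.smul
      hf.aestronglyMeasurable
  have hfar : ∀ t, f t ≠ 0 → ∀ z ∈ Metric.ball w (δ / 2), δ / 2 ≤ ‖z - t‖ := by
    intro t ht z hz
    have h1 : δ ≤ dist t w := not_lt.1 fun h => ht (h0 t h)
    have h2 := dist_triangle t z w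
    have h3 : dist z w < δ / 2 := hz
    rw [← dist_eq_norm, dist_comm]
    linarith
  rw [hswap]
  refine ⟨_, (hasDerivAt_integral_of_dominated_loc_of_deriv_le
    (F' := fun z t => ((2 * Real.pi : ℂ)⁻¹ * (-1 / (z - t) ^ 2)) • f t)
    (bound := fun t => ((2 * Real.pi)⁻¹ * ((δ / 2) ^ 2)⁻¹) * ‖f t‖)
    (Metric.ball_mem_nhds w (half_pos hδ)) (Eventually.of_forall hmeas) ?_ ?_ ?_
    (hint.norm.const_mul _) ?_).2⟩
  · have h := integrable_cauchyTransform hf hs w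
    rw [← integrable_comp_sub_left _ w] at h
    simpa using h
  · refine AEStronglyMeasurable.smul (Measurable.aestronglyMeasurable ?_) hf.aestronglyMeasurable
    fun_prop
  · refine ae_of_all _ fun t z hz => ?_
    by_cases ht : f t = 0
    · simp [ht]
    rw [norm_smul]
    gcongr
    have h := hfar t ht z hz
    have h1 : ‖(2 * Real.pi : ℂ)⁻¹ * (-1 / (z - t) ^ 2)‖
        = (2 * Real.pi)⁻¹ * (‖z - t‖ ^ 2)⁻¹ := by
      simp [abs_of_pos Real.pi_pos]
    rw [h1]
    gcongr
  · refine ae_of_all _ fun t z hz => ?_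
    by_cases ht : f t = 0
    · simpa [ht] using hasDerivAt_const z (0 : E)
    have hne : z - t ≠ 0 := norm_pos_iff.1 ((half_pos hδ).trans_le (hfar t ht z hz))
    refine HasDerivAt.smul_const ?_ _
    have h := (((hasDerivAt_id z).sub_const t).inv hne).const_mul (2 * Real.pi : ℂ)⁻¹
    simpa [cauchyKernel, mul_inv, mul_comm] using h

/-- The Cauchy transform of `f` solves `(∂_x + i ∂_y) u = f` near the points where `f` is `C¹`. -/
theorem dbar_cauchyTransform {f : ℂ → E} (hf : Continuous f) (hs : HasCompactSupport f) {w : ℂ}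
    (hw : ∀ᶠ z in 𝓝 w, ContDiffAt ℝ 1 f z) :
    ∃ D : ℂ →L[ℝ] E, HasFDerivAt (cauchyTransform f) D w ∧
      D 1 + Complex.I • D Complex.I = f w := by
  obtain ⟨δ, hδ, hball⟩ := Metric.eventually_nhds_iff_ball.1 hw
  let χ : ContDiffBump w := ⟨δ / 3, δ / 2, by positivity, by linarith⟩
  have hg : ContDiff ℝ 1 fun z => χ z • f z := by
    refine contDiff_iff_contDiffAt.2 fun z => ?_
    by_cases hz : z ∈ Metric.ball w δ
    · exact χ.contDiff.contDiffAt.smul (hball z hz)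
    · have : z ∉ tsupport fun z => χ z • f z := by
        intro h
        have h1 := tsupport_smul_subset_left _ _ h
        rw [χ.tsupport_eq] at h1
        exact hz (Metric.closedBall_subset_ball (by change δ / 2 < δ; linarith) h1)
      exact contDiffAt_const.congr_of_eventuallyEq (notMem_tsupport_iff_eventuallyEq.1 this)
  have hgs : HasCompactSupport fun z => χ z • f z := hs.smul_left
  have hh : Continuous fun z => (1 - χ z) • f z :=
    (continuous_const.sub χ.continuous).smul hf
  have hhs : HasCompactSupport fun z => (1 - χ z) • f z := hs.smul_left
  have hsum : f = (fun z => χ z • f z) + fun z => (1 - χ z) • f z := by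
    ext z; simp [sub_smul]
  obtain ⟨D, hD, hDz⟩ := dbar_cauchyTransform_of_contDiff hg hgs w
  obtain ⟨d, hd⟩ := hasDerivAt_cauchyTransform_of_eq_zero hh hhs (w := w) (δ := δ / 3)
    (by positivity) fun z hz => by
      rw [χ.one_of_mem_closedBall (Metric.ball_subset_closedBall hz), sub_self, zero_smul]
  have h2 := hd.hasFDerivAt.restrictScalars ℝ
  have h4 := hD.add h2
  rw [← cauchyTransform_add hg.continuous hgs hh hhs, ← hsum] at h4
  refine ⟨_, h4, ?_⟩
  · have h3 : χ w = 1 := χ.one_of_mem_closedBall (Metric.mem_closedBall_self (by positivity))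
    rw [h3, one_smul] at hDz
    rw [← hDz]
    simp [smul_add, smul_smul]
    abel

end CauchyTransformDbar

section Disc

/-- The closed disc of radius `4` in `ℂ`. -/
abbrev Disc : Type := Metric.closedBall (0 : ℂ) 4

/-- The radial retraction of `ℂ` onto the disc of radius `4`. -/
noncomputable def clamp : C(ℂ, Disc) where
  toFun z := ⟨(4 / max 4 ‖z‖) • z, by
    have h : (0 : ℝ) < max 4 ‖z‖ := lt_max_of_lt_left (by norm_num)
    rw [mem_closedBall_zero_iff, norm_smul, Real.norm_of_nonneg (by positivity),
      div_mul_eq_mul_div, div_le_iff₀ h]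
    gcongr
    exact le_max_right _ _⟩
  continuous_toFun := by
    have h : Continuous fun z : ℂ => 4 / max 4 ‖z‖ :=
      continuous_const.div (by fun_prop) fun z =>
        (lt_max_of_lt_left (by norm_num : (0 : ℝ) < 4)).ne'
    exact (h.smul continuous_id).subtype_mk _

theorem clamp_of_norm_le {z : ℂ} (hz : ‖z‖ ≤ 4) : (clamp z : ℂ) = z := by
  simp [clamp, max_eq_left hz]

@[simp]
theorem clamp_coe (z : Disc) : clamp (z : ℂ) = z :=
  Subtype.ext (clamp_of_norm_le (mem_closedBall_zero_iff.1 z.2))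

theorem le_norm_clamp {z : ℂ} {r : ℝ} (hr : r ≤ 4) (hz : r ≤ ‖z‖) : r ≤ ‖(clamp z : ℂ)‖ := by
  rcases le_total ‖z‖ 4 with h | h
  · rwa [clamp_of_norm_le h]
  · have h0 : ‖z‖ ≠ 0 := by linarith
    change r ≤ ‖(4 / max 4 ‖z‖) • z‖
    rw [max_eq_right h, norm_smul, norm_div, norm_norm, div_mul_cancel₀ _ h0]
    simpa using hr

theorem norm_disc_le (z : Disc) : ‖(z : ℂ)‖ ≤ 4 := mem_closedBall_zero_iff.1 z.2

/-- The cutoff used to extend functions on the disc to compactly supported ones. -/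
noncomputable def outerCutoff : ContDiffBump (0 : ℂ) := ⟨37 / 10, 39 / 10, by norm_num, by norm_num⟩

variable {E : Type*} [NormedAddCommGroup E] [NormedSpace ℝ E]

/-- The cut-off extension of a function on the disc. -/
noncomputable def cutoffExtend (f : C(Disc, E)) (z : ℂ) : E := outerCutoff z • f (clamp z)

theorem continuous_cutoffExtend (f : C(Disc, E)) : Continuous (cutoffExtend f) :=
  outerCutoff.continuous.smul (f.continuous.comp clamp.continuous)

theorem support_cutoffExtend (f : C(Disc, E)) :
    Function.support (cutoffExtend f) ⊆ Metric.ball 0 5 := by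
  refine (Function.support_smul_subset_left _ _).trans ?_
  rw [outerCutoff.support_eq]
  exact Metric.ball_subset_ball (by change (39 / 10 : ℝ) ≤ 5; norm_num)

theorem hasCompactSupport_cutoffExtend (f : C(Disc, E)) : HasCompactSupport (cutoffExtend f) :=
  outerCutoff.hasCompactSupport.smul_right

theorem norm_cutoffExtend_le (f : C(Disc, E)) (z : ℂ) : ‖cutoffExtend f z‖ ≤ ‖f‖ := by
  rw [cutoffExtend, norm_smul, Real.norm_of_nonneg outerCutoff.nonneg]
  exact (mul_le_of_le_one_left (norm_nonneg _) outerCutoff.le_one).trans (f.norm_coe_le_norm _)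

theorem cutoffExtend_of_norm_le (f : C(Disc, E)) {z : ℂ} (hz : ‖z‖ ≤ 37 / 10) :
    cutoffExtend f z = f (clamp z) := by
  rw [cutoffExtend, outerCutoff.one_of_mem_closedBall (mem_closedBall_zero_iff.2 hz), one_smul]

/-- Integration along rays from the origin. -/
noncomputable def rayIntegral : C(Disc, ℂ →L[ℝ] E) →L[ℝ] C(Disc, E) :=
  LinearMap.mkContinuous (E := C(Disc, ℂ →L[ℝ] E)) (F := C(Disc, E)) (σ := RingHom.id ℝ)
    { toFun := fun g => ⟨fun z => ∫ t in (0 : ℝ)..1, g (clamp (t • (z : ℂ))) z,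
        intervalIntegral.continuous_parametric_intervalIntegral_of_continuous' (by
          refine Continuous.clm_apply (g.continuous.comp (clamp.continuous.comp ?_)) ?_ <;>
          fun_prop) _ _⟩
      map_add' := fun g h => by
        ext z
        simp only [ContinuousMap.add_apply, ContinuousMap.coe_mk, add_apply]
        refine intervalIntegral.integral_add ?_ ?_ <;>
        exact Continuous.intervalIntegrable (by fun_prop) _ _
      map_smul' := fun c g => by
        ext z
        simp [intervalIntegral.integral_smul] } 4
    (fun g => by
      rw [ContinuousMap.norm_le _ (by positivity)]
      intro z
      have h := intervalIntegral.norm_integral_le_of_norm_le_const (a := 0) (b := 1)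
        (f := fun t : ℝ => g (clamp (t • (z : ℂ))) z) (C := ‖g‖ * 4) fun t _ =>
          (g _).le_of_opNorm_le_of_le (g.norm_coe_le_norm _) (norm_disc_le z)
      simpa [mul_comm] using h)

theorem rayIntegral_apply (g : C(Disc, ℂ →L[ℝ] E)) (z : Disc) :
    rayIntegral g z = ∫ t in (0 : ℝ)..1, g (clamp (t • (z : ℂ))) z := rfl

variable [NormedSpace ℂ E] [IsScalarTower ℝ ℂ E]

/-- The Cauchy transform as an operator on functions on the disc. -/
noncomputable def discCauchy : C(Disc, E) →L[ℝ] C(Disc, E) :=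
  LinearMap.mkContinuous (E := C(Disc, E)) (F := C(Disc, E)) (σ := RingHom.id ℝ)
    { toFun := fun f => ⟨fun z => cauchyTransform (cutoffExtend f) z,
        (continuous_cauchyTransform (continuous_cutoffExtend f)
          (hasCompactSupport_cutoffExtend f)).comp continuous_subtype_val⟩
      map_add' := fun f g => by
        ext z
        have h : cutoffExtend (f + g) = cutoffExtend f + cutoffExtend g := by
          ext w; simp [cutoffExtend]
        simp only [h, ContinuousMap.coe_mk, ContinuousMap.add_apply]
        rw [cauchyTransform_add (continuous_cutoffExtend f) (hasCompactSupport_cutoffExtend f)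
          (continuous_cutoffExtend g) (hasCompactSupport_cutoffExtend g)]
        rfl
      map_smul' := fun c f => by
        ext z
        have h : cutoffExtend (c • f) = c • cutoffExtend f := by
          ext w; simp [cutoffExtend, smul_comm c]
        simp only [h, ContinuousMap.coe_mk, cauchyTransform_smul]
        rfl }
    (∫ t in Metric.ball (0 : ℂ) (2 * 5), ‖cauchyKernel t‖)
    (fun f => by
      rw [ContinuousMap.norm_le _ (by positivity)]
      intro z
      exact norm_cauchyTransform_le (norm_cutoffExtend_le f) (support_cutoffExtend f)
        (mem_ball_zero_iff.2 ((norm_disc_le z).trans_lt (by norm_num))))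

theorem discCauchy_apply (f : C(Disc, E)) (z : Disc) :
    discCauchy f z = cauchyTransform (cutoffExtend f) z := rfl

theorem discCauchy_dilation (f g : C(Disc, E)) {c : ℂ} (hc : 5 / 6 ≤ ‖c‖) (hc1 : ‖c‖ ≤ 1)
    (hfg : ∀ z : Disc, g z = f (clamp (c * z))) (hf : ∀ z : Disc, 3 ≤ ‖(z : ℂ)‖ → f z = 0)
    (z : Disc) :
    discCauchy f (clamp (c * z)) = (starRingEnd ℂ c) • discCauchy g z := by
  have hc0 : c ≠ 0 := norm_pos_iff.1 (by linarith)
  have hcle : ∀ w : ℂ, ‖c * w‖ ≤ ‖w‖ := fun w => by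
    rw [norm_mul]; exact mul_le_of_le_one_left (norm_nonneg _) hc1
  rw [discCauchy_apply, discCauchy_apply, clamp_of_norm_le ((hcle z).trans (norm_disc_le z)),
    cauchyTransform_dilation _ hc0]
  congr 2
  ext w
  rcases le_total ‖w‖ (37 / 10) with h | h
  · rw [cutoffExtend_of_norm_le _ h, cutoffExtend_of_norm_le _ ((hcle w).trans h), hfg,
      clamp_of_norm_le (h.trans (by norm_num))]
  · have h1 : ∀ w : ℂ, 37 / 10 ≤ ‖w‖ → f (clamp (c * w)) = 0 := fun w h => by
      refine hf _ (le_norm_clamp (by norm_num) ?_)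
      rw [norm_mul]
      nlinarith
    rw [cutoffExtend, cutoffExtend, h1 w h, hfg, h1 _ (le_norm_clamp (by norm_num) h), smul_zero,
      smul_zero]

end Disc

theorem hasDerivAt_id_smul_of_continuousAt {F : Type*} [NormedAddCommGroup F] [NormedSpace ℝ F]
    {g : ℝ → F} (hg : ContinuousAt g 0) : HasDerivAt (fun t => t • g t) (g 0) 0 := by
  rw [hasDerivAt_iff_tendsto_slope]
  refine (hg.tendsto.mono_left nhdsWithin_le_nhds).congr' ?_
  filter_upwards [self_mem_nhdsWithin] with t ht
  simp [slope, inv_smul_smul₀ ht]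

section FixedPoint

variable {E : Type} [NormedAddCommGroup E] [NormedSpace ℝ E] {r : ℕ}

/-- Parameters of the fixed point equation: an initial value, the coefficients of a polynomial, and
a dilation factor. -/
abbrev Param (E : Type) (r : ℕ) : Type := (E × (Fin r → E)) × ℂ

/-- Sampling of the parameters, the dilated position and an unknown function at the points of the
disc. -/
noncomputable def sample :
    (Param E r × C(Disc, E × E)) →L[ℝ] C(Disc, Param E r × (ℂ × (E × E))) :=
  LinearMap.mkContinuous (E := Param E r × C(Disc, E × E))
    (F := C(Disc, Param E r × (ℂ × (E × E)))) (σ := RingHom.id ℝ)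
    { toFun := fun w => ⟨fun z => (w.1, (w.1.2 * z, w.2 z)), by fun_prop⟩
      map_add' := fun w w' => by ext z <;> simp [add_mul]
      map_smul' := fun c w => by ext z <;> simp [mul_assoc] } 4
    (fun w => by
      rw [ContinuousMap.norm_le _ (by positivity)]
      intro z
      have h1 := norm_fst_le w
      have h2 := (w.2.norm_coe_le_norm z).trans (norm_snd_le w)
      have h3 : ‖w.1.2 * (z : ℂ)‖ ≤ ‖w‖ * 4 := by
        rw [norm_mul]
        exact mul_le_mul ((norm_snd_le _).trans h1) (norm_disc_le z) (norm_nonneg _)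
          (norm_nonneg _)
      have h4 := norm_nonneg w
      refine max_le (h1.trans ?_) (max_le (h3.trans ?_) (h2.trans ?_)) <;> linarith)

@[simp]
theorem sample_apply (w : Param E r × C(Disc, E × E)) (z : Disc) :
    sample w z = (w.1, (w.1.2 * z, w.2 z)) := rfl

section Linearization

variable {B : Type} [NormedAddCommGroup B] [NormedSpace ℝ B]

theorem hasFDerivAt_superposition_sample (F : C(Param E r × (ℂ × (E × E)), B))
    (hF : ContDiff ℝ ∞ F) (w : Param E r × C(Disc, E × E)) :
    ∃ L : (Param E r × C(Disc, E × E)) →L[ℝ] C(Disc, B),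
      HasFDerivAt (fun w => F.comp (sample w)) L w ∧
      ∀ δ z, L δ z = fderiv ℝ F (sample w z) (sample δ z) :=
  ⟨_, HasFDerivAt.comp (g := fun U : C(Disc, _) => F.comp U) (f := sample) w
    (hasFDerivAt_superposition F ⟨fderiv ℝ F, hF.continuous_fderiv (by simp)⟩
      (fun a => (hF.differentiable (by simp) a).hasFDerivAt) _)
    (ContinuousLinearMap.hasFDerivAt _), fun _ _ => rfl⟩

theorem fderiv_sample_of_eq_smul (F : C(Param E r × (ℂ × (E × E)), B))
    (hF : ContDiff ℝ ∞ F) (w δ : Param E r × C(Disc, E × E)) (z : Disc) (g : ℝ → B)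
    (hg : ContinuousAt g 0) (h : ∀ t : ℝ, F (sample (w + t • δ) z) = t • g t) :
    fderiv ℝ F (sample w z) (sample δ z) = g 0 := by
  have h1 : HasDerivAt (fun t : ℝ => sample w z + t • sample δ z) (sample δ z) 0 := by
    simpa using ((hasDerivAt_id (0 : ℝ)).smul_const (sample δ z)).const_add (sample w z)
  have h0 : sample w z + (0 : ℝ) • sample δ z = sample w z := by simp
  have h2 := (hF.differentiable (by simp) (sample w z + (0 : ℝ) • sample δ z)).hasFDerivAt
    |>.comp_hasDerivAt (0 : ℝ) h1
  rw [h0] at h2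
  refine h2.unique ?_
  have h3 : (F ∘ fun t : ℝ => sample w z + t • sample δ z) = fun t => t • g t := by
    ext t
    rw [← h t, map_add, map_smul]
    rfl
  rw [h3]
  exact hasDerivAt_id_smul_of_continuousAt hg

end Linearization

/-- The cutoff in front of the nonlinearity. -/
noncomputable def innerCutoff : ContDiffBump (0 : ℂ) := ⟨2, 3, by norm_num, by norm_num⟩

variable [NormedSpace ℂ E] [IsScalarTower ℝ ℂ E]

/-- The polynomial with coefficients `c` centred at `7 / 8`. -/
noncomputable def centredPoly (c : Fin r → E) (s : ℂ) : E := ∑ j : Fin r, (s - 7 / 8) ^ (j : ℕ) • c j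

theorem contDiff_centredPoly :
    ContDiff ℝ ∞ fun x : (Fin r → E) × ℂ => centredPoly x.1 x.2 := by
  unfold centredPoly
  fun_prop

theorem centredPoly_smul (t : ℝ) (c : Fin r → E) (s : ℂ) :
    centredPoly (t • c) s = t • centredPoly c s := by
  simp [centredPoly, Finset.smul_sum, smul_comm t]

/-- The affine part of the fixed point equation. -/
noncomputable def affinePart : C(Param E r × (ℂ × (E × E)), E × E) where
  toFun x := (x.1.1.1, centredPoly x.1.1.2 x.2.1)
  continuous_toFun := by
    refine Continuous.prodMk (by fun_prop) ?_
    exact contDiff_centredPoly.continuous.comp (f := fun x : Param E r × (ℂ × (E × E)) =>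
      (x.1.1.2, x.2.1)) (by fun_prop)

theorem contDiff_affinePart : ContDiff ℝ ∞ (affinePart (E := E) (r := r)) := by
  refine ContDiff.prodMk (by fun_prop) ?_
  exact contDiff_centredPoly.comp (f := fun x : Param E r × (ℂ × (E × E)) =>
    (x.1.1.2, x.2.1)) (by fun_prop)

variable (Ψ : C(E, E →L[ℝ] E)) (q : C(E × E, E))

/-- The differential of the first component of the unknown, in terms of both components. -/
noncomputable def differentialPart : C(Param E r × (ℂ × (E × E)), ℂ →L[ℝ] E) where
  toFun x := Ψ x.2.2.1 ∘L (ContinuousLinearMap.lsmul ℝ ℂ).flip (x.1.2 • x.2.2.2)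
  continuous_toFun := by fun_prop

theorem contDiff_differentialPart (hΨ : ContDiff ℝ ∞ Ψ) :
    ContDiff ℝ ∞ (differentialPart (r := r) Ψ) := by
  refine ContDiff.clm_comp (hΨ.comp (by fun_prop)) ?_
  exact (ContinuousLinearMap.contDiff _).comp (by fun_prop)

/-- The localized nonlinearity. -/
noncomputable def nonlinearPart : C(Param E r × (ℂ × (E × E)), E) where
  toFun x := (starRingEnd ℂ x.1.2) • innerCutoff x.2.1 • q x.2.2
  continuous_toFun := by
    refine Continuous.smul (by fun_prop) (Continuous.smul ?_ (by fun_prop))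
    exact innerCutoff.continuous.comp (by fun_prop)

theorem contDiff_nonlinearPart (hq : ContDiff ℝ ∞ q) :
    ContDiff ℝ ∞ (nonlinearPart (r := r) q) := by
  refine ContDiff.smul (Complex.conjCLE.contDiff.comp (by fun_prop)) (ContDiff.smul ?_ ?_)
  · exact innerCutoff.contDiff.comp (by fun_prop)
  · exact hq.comp (by fun_prop)

/-- The residual of the fixed point equation for pairs `(u, ξ)` of functions on the disc. -/
noncomputable def fpResidual (w : Param E r × C(Disc, E × E)) : C(Disc, E × E) :=
  w.2 - (affinePart.comp (sample w) +
    ((ContinuousLinearMap.inl ℝ E E).compLeftContinuous ℝ Disc)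
      (rayIntegral ((differentialPart Ψ).comp (sample w))) +
    ((ContinuousLinearMap.inr ℝ E E).compLeftContinuous ℝ Disc)
      (discCauchy ((nonlinearPart q).comp (sample w))))

theorem contDiff_fpResidual (hΨ : ContDiff ℝ ∞ Ψ) (hq : ContDiff ℝ ∞ q) :
    ContDiff ℝ ∞ (fpResidual (r := r) Ψ q) := by
  unfold fpResidual
  have hS : ContDiff ℝ ∞ (sample (E := E) (r := r)) := ContinuousLinearMap.contDiff _
  have h1 := (contDiff_superposition (K := Disc) _ (contDiff_affinePart (E := E) (r := r))).comp hS
  have h2 := (contDiff_superposition (K := Disc) _ (contDiff_differentialPart (r := r) Ψ hΨ)).comp hS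
  have h3 := (contDiff_superposition (K := Disc) _ (contDiff_nonlinearPart (r := r) q hq)).comp hS
  refine contDiff_snd.sub ((h1.add ?_).add ?_)
  · exact ((ContinuousLinearMap.inl ℝ E E).compLeftContinuous ℝ Disc).contDiff.comp
      (ContDiff.comp (g := rayIntegral) (ContinuousLinearMap.contDiff _) h2)
  · exact ((ContinuousLinearMap.inr ℝ E E).compLeftContinuous ℝ Disc).contDiff.comp
      (ContDiff.comp (g := discCauchy) (ContinuousLinearMap.contDiff _) h3)

/-- The linearization of the fixed point equation at the zero solution. -/
theorem hasFDerivAt_fpResidual (hΨ : ContDiff ℝ ∞ Ψ) (hq : ContDiff ℝ ∞ q)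
    (hΨ0 : Ψ 0 = ContinuousLinearMap.id ℝ E)
    (hq2 : ∀ (t : ℝ) u ξ, q (u, t • ξ) = t ^ 2 • q (u, ξ)) (c : ℂ) :
    ∃ L : (Param E r × C(Disc, E × E)) →L[ℝ] C(Disc, E × E),
      HasFDerivAt (fpResidual Ψ q) L ((0, c), 0) ∧ ∀ δ z,
        L δ z = (((δ.2 z).1 - δ.1.1.1 -
          ∫ t in (0 : ℝ)..1, ((z : ℂ) * c) • (δ.2 (clamp (t • (z : ℂ)))).2),
            (δ.2 z).2 - centredPoly δ.1.1.2 (c * z)) := by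
  have : SMulCommClass ℝ ℂ E := IsScalarTower.to_smulCommClass
  obtain ⟨L₁, hL₁, h₁⟩ := hasFDerivAt_superposition_sample (affinePart (E := E) (r := r))
    (contDiff_affinePart (E := E) (r := r)) ((0, c), 0)
  obtain ⟨L₂, hL₂, h₂⟩ := hasFDerivAt_superposition_sample (differentialPart (r := r) Ψ)
    (contDiff_differentialPart (r := r) Ψ hΨ) ((0, c), 0)
  obtain ⟨L₃, hL₃, h₃⟩ := hasFDerivAt_superposition_sample (nonlinearPart (r := r) q)
    (contDiff_nonlinearPart (r := r) q hq) ((0, c), 0)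
  have hL₂' : HasFDerivAt (fun w : Param E r × C(Disc, E × E) =>
      rayIntegral ((differentialPart Ψ).comp (sample w))) (rayIntegral.comp L₂) ((0, c), 0) :=
    HasFDerivAt.comp _ (ContinuousLinearMap.hasFDerivAt _) hL₂
  have hL₃' : HasFDerivAt (fun w : Param E r × C(Disc, E × E) =>
      discCauchy ((nonlinearPart q).comp (sample w))) (discCauchy.comp L₃) ((0, c), 0) :=
    HasFDerivAt.comp _ (ContinuousLinearMap.hasFDerivAt _) hL₃
  have hL₂'' := HasFDerivAt.comp (g := (ContinuousLinearMap.inl ℝ E E).compLeftContinuous ℝ Disc)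
    _ (ContinuousLinearMap.hasFDerivAt _) hL₂'
  have hL₃'' := HasFDerivAt.comp (g := (ContinuousLinearMap.inr ℝ E E).compLeftContinuous ℝ Disc)
    _ (ContinuousLinearMap.hasFDerivAt _) hL₃'
  refine ⟨_, hasFDerivAt_snd.sub ((hL₁.add hL₂'').add hL₃''), fun δ z => ?_⟩
  have e₁ : ∀ δ z, L₁ δ z = (δ.1.1.1, centredPoly δ.1.1.2 (c * z)) := fun δ z => by
    rw [h₁, fderiv_sample_of_eq_smul _ contDiff_affinePart _ _ _
      (fun t => (δ.1.1.1, centredPoly δ.1.1.2 ((c + t • δ.1.2) * z)))]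
    · simp
    · refine Continuous.continuousAt (Continuous.prodMk (by fun_prop) ?_)
      exact contDiff_centredPoly.continuous.comp
        (f := fun t : ℝ => (δ.1.1.2, (c + t • δ.1.2) * (z : ℂ))) (by fun_prop)
    · intro t
      simp [affinePart, centredPoly_smul, add_mul, mul_assoc]
  have e₂ : ∀ δ z, L₂ δ z = (ContinuousLinearMap.lsmul ℝ ℂ).flip (c • (δ.2 z).2) := fun δ z => by
    rw [h₂, fderiv_sample_of_eq_smul _ (contDiff_differentialPart Ψ hΨ) _ _ _
      (fun t => Ψ (t • (δ.2 z).1) ∘L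
        (ContinuousLinearMap.lsmul ℝ ℂ).flip ((c + t • δ.1.2) • (δ.2 z).2))]
    · simp [hΨ0]
    · exact Continuous.continuousAt (by fun_prop)
    · intro t
      simp [differentialPart, smul_comm _ t]
  have e₃ : L₃ δ = 0 := by
    ext z
    rw [h₃, fderiv_sample_of_eq_smul _ (contDiff_nonlinearPart q hq) _ _ _
      (fun t => t • ((starRingEnd ℂ (c + t • δ.1.2)) • innerCutoff ((c + t • δ.1.2) * z) •
        q (t • (δ.2 z).1, (δ.2 z).2)))]
    · simp
    · refine Continuous.continuousAt (continuous_id.smul (Continuous.smul (by fun_prop)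
        (Continuous.smul ?_ (by fun_prop))))
      exact innerCutoff.continuous.comp (by fun_prop)
    · intro t
      have h : q (t • δ.2 z) = t ^ 2 • q (t • (δ.2 z).1, (δ.2 z).2) := hq2 t _ _
      simp [nonlinearPart, h, pow_two, mul_smul, smul_comm _ t, add_mul, mul_assoc]
  have e₄ : rayIntegral (L₂ δ) z =
      ∫ t in (0 : ℝ)..1, ((z : ℂ) * c) • (δ.2 (clamp (t • (z : ℂ)))).2 := by
    rw [rayIntegral_apply]
    simp [e₂, mul_smul]
  rw [← e₄]
  ext <;> simp [e₁, e₃, sub_sub]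

theorem isInvertible_fderiv_fpResidual (hΨ : ContDiff ℝ ∞ Ψ) (hq : ContDiff ℝ ∞ q)
    (hΨ0 : Ψ 0 = ContinuousLinearMap.id ℝ E)
    (hq2 : ∀ (t : ℝ) u ξ, q (u, t • ξ) = t ^ 2 • q (u, ξ)) (c : ℂ) :
    (fderiv ℝ (fpResidual (r := r) Ψ q) ((0, c), 0) ∘L
      .inr ℝ (Param E r) C(Disc, E × E)).IsInvertible := by
  obtain ⟨L, hL, hLz⟩ := hasFDerivAt_fpResidual (r := r) Ψ q hΨ hq hΨ0 hq2 c
  rw [hL.fderiv]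
  set M := L ∘L .inr ℝ (Param E r) C(Disc, E × E) with hM
  have hMz : ∀ V z, M V z = ((V z).1 -
      ∫ t in (0 : ℝ)..1, ((z : ℂ) * c) • (V (clamp (t • (z : ℂ)))).2, (V z).2) := fun V z => by
    simp [hM, hLz, centredPoly]
  have h2 : M.comp M = (2 : ℝ) • M - ContinuousLinearMap.id ℝ _ := by
    ext V z
    · simp [hMz, two_smul]
      abel
    · simp [hMz, two_smul]
  refine ContinuousLinearMap.IsInvertible.of_inverse
    (g := (2 : ℝ) • ContinuousLinearMap.id ℝ _ - M) ?_ ?_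
  · rw [ContinuousLinearMap.comp_sub, h2]
    ext V z <;> simp
  · rw [ContinuousLinearMap.sub_comp, h2]
    ext V z <;> simp

end FixedPoint

section Solution

theorem discCauchy_const_smul {E : Type*} [NormedAddCommGroup E] [NormedSpace ℝ E]
    [NormedSpace ℂ E] [IsScalarTower ℝ ℂ E] (c : ℂ) (f g : C(Disc, E)) (h : ∀ z, g z = c • f z)
    (z : Disc) : discCauchy g z = c • discCauchy f z := by
  have : SMulCommClass ℝ ℂ E := IsScalarTower.to_smulCommClass
  simp only [discCauchy_apply, cauchyTransform_apply, ← integral_smul, cutoffExtend, h,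
    smul_comm c]

/-- The dilation of a function on the disc. -/
noncomputable def dilate {F : Type*} [TopologicalSpace F] (c : ℂ) (f : C(Disc, F)) : C(Disc, F) :=
  ⟨fun z => f (clamp (c * z)), by fun_prop⟩

variable {E : Type} [NormedAddCommGroup E] [NormedSpace ℝ E] {r : ℕ}
  [NormedSpace ℂ E] [IsScalarTower ℝ ℂ E] (Ψ : C(E, E →L[ℝ] E)) (q : C(E × E, E))

theorem fpResidual_apply (a : Param E r) (U : C(Disc, E × E)) (z : Disc) :
    fpResidual Ψ q (a, U) z = ((U z).1 - (a.1.1 +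
      ∫ t in (0 : ℝ)..1, Ψ (U (clamp (t • (z : ℂ)))).1
        ((z : ℂ) • a.2 • (U (clamp (t • (z : ℂ)))).2)),
      (U z).2 - (centredPoly a.1.2 (a.2 * z) +
        discCauchy ((nonlinearPart q).comp (sample (a, U))) z)) := by
  simp only [fpResidual, ContinuousMap.sub_apply, ContinuousMap.add_apply]
  ext <;> simp [rayIntegral_apply, differentialPart, affinePart]

theorem fpResidual_dilate {c : E × (Fin r → E)} {U : C(Disc, E × E)}
    (h : fpResidual Ψ q ((c, 1), U) = 0) {l : ℂ} (hl : 5 / 6 ≤ ‖l‖) (hl1 : ‖l‖ ≤ 1) :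
    fpResidual Ψ q ((c, l), dilate l U) = 0 := by
  have hle : ∀ z : Disc, ‖l * z‖ ≤ 4 := fun z => by
    rw [norm_mul]
    nlinarith [norm_disc_le z, norm_nonneg (z : ℂ)]
  ext1 z
  have h1 := congrArg (fun f => f (clamp (l * z))) h
  simp only [fpResidual_apply, clamp_of_norm_le (hle z), ContinuousMap.zero_apply] at h1
  rw [fpResidual_apply, ContinuousMap.zero_apply, ← h1]
  have hray : ∫ t in (0 : ℝ)..1, Ψ (dilate l U (clamp (t • (z : ℂ)))).1
        ((z : ℂ) • l • (dilate l U (clamp (t • (z : ℂ)))).2) =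
      ∫ t in (0 : ℝ)..1, Ψ (U (clamp (t • (l * (z : ℂ))))).1
        ((l * (z : ℂ)) • (1 : ℂ) • (U (clamp (t • (l * (z : ℂ))))).2) := by
    refine intervalIntegral.integral_congr fun t ht => ?_
    rw [uIcc_of_le zero_le_one] at ht
    have h2 : (clamp (t • (z : ℂ)) : ℂ) = t • (z : ℂ) := clamp_of_norm_le (by
      rw [norm_smul, Real.norm_of_nonneg ht.1]
      nlinarith [norm_disc_le z, norm_nonneg (z : ℂ), ht.2])
    simp only [dilate, ContinuousMap.coe_mk, h2, smul_mul_assoc, one_smul, smul_smul, mul_comm l]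
  have hcau : discCauchy ((nonlinearPart q).comp (sample ((c, l), dilate l U))) z =
      discCauchy ((nonlinearPart q).comp (sample ((c, 1), U))) (clamp (l * z)) := by
    rw [discCauchy_dilation ((nonlinearPart q).comp (sample ((c, 1), U)))
      (dilate l ((nonlinearPart q).comp (sample ((c, 1), U)))) hl hl1 (fun _ => rfl)]
    · refine discCauchy_const_smul _ _ _ (fun z => ?_) z
      simp [nonlinearPart, dilate, clamp_of_norm_le (hle z)]
    · intro z hz
      have : innerCutoff (z : ℂ) = 0 := innerCutoff.zero_of_le_dist (by simpa [innerCutoff] using hz)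
      simp [nonlinearPart, this]
  rw [hray, hcau]
  simp [dilate]

theorem fpResidual_zero (hq2 : ∀ (t : ℝ) u ξ, q (u, t • ξ) = t ^ 2 • q (u, ξ)) (l : ℂ) :
    fpResidual (r := r) Ψ q ((0, l), 0) = 0 := by
  have h0 : q (0, 0) = 0 := by simpa using hq2 0 0 0
  have : (nonlinearPart q).comp (sample (r := r) ((0, l), 0)) = 0 := by
    ext z
    change starRingEnd ℂ l • innerCutoff (l * z) • q (0, 0) = 0
    rw [h0, smul_zero, smul_zero]
  ext1 z
  rw [fpResidual_apply, this]
  simp [centredPoly]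

/-- The small solutions of the fixed point equation form a smooth family, which is compatible with
dilations. -/
theorem exists_solution_family [CompleteSpace E] (hΨ : ContDiff ℝ ∞ Ψ) (hq : ContDiff ℝ ∞ q)
    (hΨ0 : Ψ 0 = ContinuousLinearMap.id ℝ E)
    (hq2 : ∀ (t : ℝ) u ξ, q (u, t • ξ) = t ^ 2 • q (u, ξ)) :
    ∃ (𝒰 : Param E r → C(Disc, E × E)) (W : E × (Fin r → E) → C(Disc, E × E)),
      Tendsto W (𝓝 0) (𝓝 0) ∧ (∀ᶠ c in 𝓝 0, fpResidual Ψ q ((c, 1), W c) = 0) ∧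
      (∀ᶠ a in 𝓝 ((0, 7 / 8) : Param E r), ContDiffAt ℝ ∞ 𝒰 a ∧ fpResidual Ψ q (a, 𝒰 a) = 0 ∧
        ∀ z : Disc, W a.1 (clamp (a.2 * z)) = 𝒰 a z) ∧
      ∀ᶠ l in 𝓝 (7 / 8 : ℂ), 𝒰 (0, l) = 0 := by
  have hsm := contDiff_fpResidual (r := r) Ψ q hΨ hq
  have hinv := isInvertible_fderiv_fpResidual (r := r) Ψ q hΨ hq hΨ0 hq2
  have hz := fpResidual_zero (r := r) Ψ q hq2
  have hdl := fun c U l => fpResidual_dilate (r := r) (c := c) (U := U) (l := l) Ψ q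
  generalize fpResidual (r := r) Ψ q = G at hsm hinv hz hdl ⊢
  obtain ⟨ψ, hψ0, hψ, -⟩ := exists_smooth_implicit _ hsm (0, 1) 0 (hz 1) (hinv 1)
  obtain ⟨𝒰, h𝒰0, h𝒰, hu⟩ := exists_smooth_implicit _ hsm (0, 7 / 8) 0 (hz (7 / 8)) (hinv (7 / 8))
  have hin : Tendsto (fun c : E × (Fin r → E) => (c, (1 : ℂ))) (𝓝 0) (𝓝 (0, 1)) :=
    (Continuous.prodMk continuous_id continuous_const).tendsto _
  have hW : Tendsto (fun c => ψ (c, 1)) (𝓝 0) (𝓝 0) := by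
    have h1 := (hψ.self_of_nhds.1.continuousAt).tendsto.comp hin
    rwa [hψ0] at h1
  refine ⟨𝒰, fun c => ψ (c, 1), hW, (hin.eventually hψ).mono fun c h => h.2, ?_, ?_⟩
  · have hfst : Tendsto (fun a : Param E r => a.1) (𝓝 (0, 7 / 8)) (𝓝 0) :=
      continuous_fst.tendsto _
    have hsnd : Tendsto (fun a : Param E r => ‖a.2‖) (𝓝 (0, 7 / 8)) (𝓝 (7 / 8)) := by
      have := (continuous_snd.norm : Continuous fun a : Param E r => ‖a.2‖).tendsto (0, 7 / 8)
      simpa using this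
    have hdil : Tendsto (fun a : Param E r => (a, dilate a.2 (ψ (a.1, 1)))) (𝓝 (0, 7 / 8))
        (𝓝 ((0, 7 / 8), 0)) := by
      refine tendsto_id.prodMk_nhds ?_
      rw [tendsto_zero_iff_norm_tendsto_zero]
      refine squeeze_zero (fun _ => norm_nonneg _) (fun a => ?_)
        (tendsto_zero_iff_norm_tendsto_zero.1 (hW.comp hfst))
      rw [ContinuousMap.norm_le _ (norm_nonneg _)]
      exact fun z => (ψ (a.1, 1)).norm_coe_le_norm (clamp (a.2 * z))
    have e1 : ∀ᶠ a : Param E r in 𝓝 (0, 7 / 8), G (a, dilate a.2 (ψ (a.1, 1))) = 0 →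
        𝒰 a = dilate a.2 (ψ (a.1, 1)) := hdil.eventually hu
    have e2 : ∀ᶠ a : Param E r in 𝓝 (0, 7 / 8), G ((a.1, 1), ψ (a.1, 1)) = 0 :=
      hfst.eventually ((hin.eventually hψ).mono fun c h => h.2)
    have e3 : ∀ᶠ a : Param E r in 𝓝 (0, 7 / 8), ‖a.2‖ ∈ Icc (5 / 6 : ℝ) 1 :=
      hsnd.eventually (Icc_mem_nhds (by norm_num) (by norm_num))
    filter_upwards [h𝒰, e1, e2, e3] with a h1 h2 h3 h4
    refine ⟨h1.1, h1.2, fun z => ?_⟩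
    rw [h2 (hdl _ _ _ h3 h4.1 h4.2)]
    rfl
  · have hl : Tendsto (fun l : ℂ => (((0, l), 0) : Param E r × C(Disc, E × E))) (𝓝 (7 / 8))
        (𝓝 ((0, 7 / 8), 0)) := Continuous.tendsto (by fun_prop) _
    filter_upwards [hl.eventually hu] with l h
    exact h (hz l)

end Solution

section RadialTransport

variable {E : Type*} [NormedAddCommGroup E] [NormedSpace ℝ E]

theorem two_le_infty : (2 : ℕ∞ω) ≤ ∞ := WithTop.coe_le_coe.2 (le_top (a := (2 : ℕ∞)))

theorem bilin_sub_swap (b : ℂ →L[ℝ] ℂ →L[ℝ] E) (v w : ℂ) :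
    b v w - b w v = (w.re * v.im - w.im * v.re) • (b Complex.I 1 - b 1 Complex.I) := by
  have h : ∀ z : ℂ, z = z.re • (1 : ℂ) + z.im • Complex.I := fun z => by simp
  rw [h v, h w]
  simp only [map_add, map_smul, add_apply, smul_apply]
  simp
  module

variable [NormedSpace ℂ E] [IsScalarTower ℝ ℂ E] {Ψ : E → E →L[ℝ] E} {u ξ : ℂ → E}

/-- The defect of the equation `Du(w)v = Ψ(u)(vξ)` satisfies a linear equation in the radial
direction. -/
theorem hasFDerivAt_defect (hΨ : ContDiff ℝ ∞ Ψ) {w : ℂ} (hu : ContDiffAt ℝ ∞ u w)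
    (hξ : ContDiffAt ℝ ∞ ξ w) (hrad : ∀ᶠ w in 𝓝 w, fderiv ℝ u w w = Ψ (u w) (w • ξ w))
    (hcurl : Ψ (u w) (fderiv ℝ ξ w Complex.I - Complex.I • fderiv ℝ ξ w 1) =
      fderiv ℝ Ψ (u w) (Ψ (u w) (ξ w)) (Complex.I • ξ w) -
        fderiv ℝ Ψ (u w) (Ψ (u w) (Complex.I • ξ w)) (ξ w)) (v : ℂ) :
    ∃ A : ℂ →L[ℝ] E, HasFDerivAt (fun w => fderiv ℝ u w v - Ψ (u w) (v • ξ w)) A w ∧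
      A w + (fderiv ℝ u w v - Ψ (u w) (v • ξ w)) =
        fderiv ℝ Ψ (u w) (fderiv ℝ u w v - Ψ (u w) (v • ξ w)) (w • ξ w) := by
  have hu1 : HasFDerivAt u (fderiv ℝ u w) w := (hu.differentiableAt (by simp)).hasFDerivAt
  have hξ1 : HasFDerivAt ξ (fderiv ℝ ξ w) w := (hξ.differentiableAt (by simp)).hasFDerivAt
  have hu2 : HasFDerivAt (fderiv ℝ u) (fderiv ℝ (fderiv ℝ u) w) w :=
    ((hu.fderiv_right (m := 1) (by rw [one_add_one_eq_two]; exact two_le_infty)).differentiableAt (by simp)).hasFDerivAt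
  have hΨ1 : HasFDerivAt (fun w => Ψ (u w)) (fderiv ℝ Ψ (u w) ∘L fderiv ℝ u w) w :=
    ((hΨ.differentiable (by simp) (u w)).hasFDerivAt).comp w hu1
  have hsymm : IsSymmSndFDerivAt ℝ u w := hu.isSymmSndFDerivAt (by simpa using two_le_infty)
  have hr1 : HasFDerivAt (fun w => fderiv ℝ u w w) _ w := hu2.clm_apply (hasFDerivAt_id w)
  have hr2 : HasFDerivAt (fun w => Ψ (u w) (w • ξ w)) _ w :=
    hΨ1.clm_apply ((hasFDerivAt_id w).smul hξ1)
  have hr := congrArg (fun L => L v) (hr1.unique (hr2.congr_of_eventuallyEq hrad))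
  refine ⟨_, (hu2.clm_apply (hasFDerivAt_const v w)).sub
    (hΨ1.clm_apply (hξ1.const_smul v)), ?_⟩
  have hs1 := bilin_sub_swap ((ContinuousLinearMap.lsmul ℝ ℂ).flip ∘L fderiv ℝ ξ w) v w
  have hs2 := bilin_sub_swap ((fderiv ℝ Ψ (u w) ∘L Ψ (u w)).bilinearComp
    ((ContinuousLinearMap.lsmul ℝ ℂ).flip (ξ w)) ((ContinuousLinearMap.lsmul ℝ ℂ).flip (ξ w))) v w
  have hs3 := congrArg (Ψ (u w)) hs1
  simp at hr hs1 hs2 hs3 ⊢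
  simp only [map_sub] at hcurl
  simp only [hrad.self_of_nhds, hsymm.eq w v] at hr ⊢
  rw [hcurl] at hs3
  linear_combination (norm := module) hr + hs3 + hs2

/-- If the radial part of the equation `Du(w)v = Ψ(u)(vξ)` holds, then the whole equation holds. -/
theorem fderiv_eq_of_radial (hΨ : ContDiff ℝ ∞ Ψ) (huc : Continuous u) (hξc : Continuous ξ) {R : ℝ}
    (hu : ∀ w, w ≠ 0 → ‖w‖ < R → ContDiffAt ℝ ∞ u w)
    (hξ : ∀ w, w ≠ 0 → ‖w‖ < R → ContDiffAt ℝ ∞ ξ w)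
    (hrad : ∀ w, w ≠ 0 → ‖w‖ < R → fderiv ℝ u w w = Ψ (u w) (w • ξ w))
    (hcurl : ∀ w, w ≠ 0 → ‖w‖ < R → Ψ (u w) (fderiv ℝ ξ w Complex.I - Complex.I • fderiv ℝ ξ w 1) =
      fderiv ℝ Ψ (u w) (Ψ (u w) (ξ w)) (Complex.I • ξ w) -
        fderiv ℝ Ψ (u w) (Ψ (u w) (Complex.I • ξ w)) (ξ w))
    (hlim : ∀ w v, w ≠ 0 → ‖w‖ < R →
      Tendsto (fun t : ℝ => t • fderiv ℝ u (t • w) v) (𝓝[>] 0) (𝓝 0))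
    {w : ℂ} (hw0 : w ≠ 0) (hw : ‖w‖ < R) (v : ℂ) : fderiv ℝ u w v = Ψ (u w) (v • ξ w) := by
  set a : ℂ → E := fun w => fderiv ℝ u w v - Ψ (u w) (v • ξ w) with ha
  set e : ℝ → E := fun t => t • a (t • w) with he
  have hmem : ∀ t ∈ Ioc (0 : ℝ) 1, t • w ≠ 0 ∧ ‖t • w‖ < R := fun t ht => by
    refine ⟨smul_ne_zero ht.1.ne' hw0, ?_⟩
    rw [norm_smul, Real.norm_of_nonneg ht.1.le]
    nlinarith [norm_nonneg w, ht.1, ht.2]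
  have hopen : IsOpen {w : ℂ | w ≠ 0 ∧ ‖w‖ < R} :=
    isOpen_ne.inter (isOpen_lt continuous_norm continuous_const)
  have hderiv : ∀ t ∈ Ioc (0 : ℝ) 1, HasDerivAt e
      (fderiv ℝ Ψ (u (t • w)) (e t) (w • ξ (t • w))) t := fun t ht => by
    obtain ⟨h0, h1⟩ := hmem t ht
    have hr : ∀ᶠ w in 𝓝 (t • w), fderiv ℝ u w w = Ψ (u w) (w • ξ w) :=
      by
      filter_upwards [hopen.mem_nhds (hmem t ht)] with w hw using hrad w hw.1 hw.2
    obtain ⟨A, hA, hAeq⟩ := hasFDerivAt_defect hΨ (hu _ h0 h1) (hξ _ h0 h1) hr (hcurl _ h0 h1) v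
    have h2 : HasDerivAt (fun t : ℝ => t • w) w t := by
      simpa using (hasDerivAt_id t).smul_const w
    have h3 : HasDerivAt e (t • A w + (1 : ℝ) • a (t • w)) t :=
      (hasDerivAt_id t).smul (HasFDerivAt.comp_hasDerivAt (l := a) t hA h2)
    convert h3 using 1
    have h4 : e t = t • (fderiv ℝ u (t • w) v - Ψ (u (t • w)) (v • ξ (t • w))) := rfl
    rw [one_smul, ← map_smul A, hAeq, h4, map_smul (fderiv ℝ Ψ (u (t • w))),
      smul_assoc t w, map_smul _ t, smul_apply]
  obtain ⟨K, hK⟩ : ∃ K, ∀ t ∈ Icc (0 : ℝ) 1, ‖fderiv ℝ Ψ (u (t • w))‖ * ‖w • ξ (t • w)‖ ≤ K := by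
    have hc : Continuous fun t : ℝ => ‖fderiv ℝ Ψ (u (t • w))‖ * ‖w • ξ (t • w)‖ := by
      have h1 : Continuous fun t : ℝ => fderiv ℝ Ψ (u (t • w)) :=
        (hΨ.continuous_fderiv (by simp)).comp (by fun_prop)
      have h2 : Continuous fun t : ℝ => ‖fderiv ℝ Ψ (u (t • w))‖ :=
        Continuous.norm (f := fun t : ℝ => fderiv ℝ Ψ (u (t • w))) h1
      exact h2.mul (by fun_prop)
    obtain ⟨K, hK⟩ := isCompact_Icc.bddAbove_image hc.continuousOn
    exact ⟨K, fun t ht => hK (mem_image_of_mem _ ht)⟩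
  have hK0 : 0 ≤ K := le_trans (by positivity) (hK 0 (by simp))
  have hgr : ∀ s ∈ Ioo (0 : ℝ) 1, ‖e 1‖ ≤ ‖e s‖ * Real.exp K := fun s hs => by
    have h1 := norm_le_gronwallBound_of_norm_deriv_right_le (f := e) (δ := ‖e s‖) (K := K) (ε := 0)
      (a := s) (b := 1)
      (fun t ht => (hderiv t ⟨hs.1.trans_le ht.1, ht.2⟩).continuousAt.continuousWithinAt)
      (fun t ht => (hderiv t ⟨hs.1.trans_le ht.1, ht.2.le⟩).hasDerivWithinAt) le_rfl
      (fun t ht => ?_) 1 ⟨hs.2.le, le_rfl⟩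
    · refine h1.trans ?_
      rw [gronwallBound_ε0]
      gcongr
      nlinarith [hs.1]
    · rw [add_zero]
      refine (ContinuousLinearMap.le_opNorm₂ _ _ _).trans ?_
      rw [mul_right_comm]
      exact mul_le_mul_of_nonneg_right (hK t ⟨(hs.1.trans_le ht.1).le, ht.2.le⟩) (norm_nonneg _)
  have hlim0 : Tendsto e (𝓝[>] 0) (𝓝 0) := by
    have h1 : Tendsto (fun t : ℝ => t • Ψ (u (t • w)) (v • ξ (t • w))) (𝓝[>] 0) (𝓝 0) := by
      have hc : Continuous fun t : ℝ => t • Ψ (u (t • w)) (v • ξ (t • w)) := by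
        have := hΨ.continuous
        fun_prop
      simpa using (hc.tendsto 0).mono_left nhdsWithin_le_nhds
    simpa [he, ha, smul_sub] using (hlim w v hw0 hw).sub h1
  have h0 : ‖e 1‖ ≤ 0 := by
    have h1 : Tendsto (fun s => ‖e s‖ * Real.exp K) (𝓝[>] 0) (𝓝 0) := by
      simpa using hlim0.norm.mul_const (Real.exp K)
    refine ge_of_tendsto h1 ?_
    filter_upwards [Ioo_mem_nhdsGT one_pos] with s hs using hgr s hs
  simpa [he, ha, sub_eq_zero] using norm_le_zero_iff.1 h0

end RadialTransport

section Dilation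

variable {F : Type*} [NormedAddCommGroup F] [NormedSpace ℝ F] {w : C(Disc, F)} {φ : ℂ → C(Disc, F)}

/-- A function on the disc whose dilations form a smooth family is smooth away from `0`. -/
theorem contDiffAt_of_dilations (hφ : ContDiffAt ℝ ∞ φ (7 / 8))
    (hw : ∀ᶠ l in 𝓝 (7 / 8 : ℂ), ∀ z : Disc, w (clamp (l * z)) = φ l z) {v : ℂ} (hv : v ≠ 0)
    (hv' : ‖v‖ < 7 / 2) : ContDiffAt ℝ ∞ (fun v => w (clamp v)) v := by
  have hz : ‖8 / 7 * v‖ ≤ 4 := by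
    rw [norm_mul]; norm_num; linarith
  have hl : v * (8 / 7 * v)⁻¹ = 7 / 8 := by field_simp
  have h1 : ContDiffAt ℝ ∞ (fun x => φ (x * (8 / 7 * v)⁻¹) (clamp (8 / 7 * v))) v := by
    have h2 : ContDiffAt ℝ ∞ (fun x => φ (x * (8 / 7 * v)⁻¹)) v :=
      ContDiffAt.comp (g := φ) (f := fun x => x * (8 / 7 * v)⁻¹) v (by rwa [hl])
        (contDiffAt_id.mul contDiffAt_const)
    exact (ContinuousMap.evalCLM ℝ (clamp (8 / 7 * v))).contDiff.contDiffAt.comp v h2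
  refine h1.congr_of_eventuallyEq ?_
  have h2 : Tendsto (fun x => x * (8 / 7 * v)⁻¹) (𝓝 v) (𝓝 (7 / 8)) := by
    have : Continuous fun x => x * (8 / 7 * v)⁻¹ := by fun_prop
    simpa only [hl] using this.tendsto v
  filter_upwards [h2.eventually hw] with x hx
  rw [← hx, clamp_of_norm_le hz, inv_mul_cancel_right₀ (by simpa using hv)]

theorem tendsto_smul_fderiv_of_dilations (hφ : ContDiffAt ℝ ∞ φ (7 / 8))
    (hw : ∀ᶠ l in 𝓝 (7 / 8 : ℂ), ∀ z : Disc, w (clamp (l * z)) = φ l z) {v : ℂ} (hv : v ≠ 0)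
    (hv' : ‖v‖ < 7 / 2) (x : ℂ) :
    Tendsto (fun t : ℝ => t • fderiv ℝ (fun v => w (clamp v)) (t • v) x) (𝓝[>] 0) (𝓝 0) := by
  have hφ' : HasFDerivAt φ (fderiv ℝ φ (7 / 8)) (7 / 8) :=
    (hφ.differentiableAt (by simp)).hasFDerivAt
  have heval : ∀ z : Disc, HasFDerivAt (fun l => φ l z)
      (ContinuousMap.evalCLM ℝ z ∘L fderiv ℝ φ (7 / 8)) (7 / 8) := fun z =>
    HasFDerivAt.comp (g := ContinuousMap.evalCLM ℝ z) (7 / 8)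
      (ContinuousLinearMap.hasFDerivAt _) hφ'
  set μ : ℂ := x * (7 / 8) / v with hμ
  set g : C(Disc, F) := fderiv ℝ φ (7 / 8) μ with hg
  have hg0 : g (clamp 0) = 0 := by
    have h1 : HasFDerivAt (fun l => φ l (clamp 0)) (0 : ℂ →L[ℝ] F) (7 / 8) := by
      refine (hasFDerivAt_const (w (clamp 0)) _).congr_of_eventuallyEq ?_
      filter_upwards [hw] with l hl
      rw [← hl, clamp_of_norm_le (by simp), mul_zero]
    simpa using congrArg (fun L => L μ) ((heval _).unique h1)
  have h2 : Tendsto (fun t : ℝ => g (clamp (t • (8 / 7 * v)))) (𝓝[>] 0) (𝓝 0) := by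
    have hc : Continuous fun t : ℝ => g (clamp (t • (8 / 7 * v))) := by fun_prop
    have := hc.tendsto 0
    rw [zero_smul, hg0] at this
    exact this.mono_left nhdsWithin_le_nhds
  refine h2.congr' ?_
  filter_upwards [Ioo_mem_nhdsGT one_pos] with t ht
  have hn : ‖t • v‖ < 7 / 2 := by
    rw [norm_smul, Real.norm_of_nonneg ht.1.le]
    nlinarith [norm_nonneg v, ht.2]
  have hz : ‖t • (8 / 7 * v)‖ ≤ 4 := by
    rw [← mul_smul_comm, norm_mul]; norm_num at hn ⊢; linarith
  have hl : 7 / 8 * (t • (8 / 7 * v)) = t • v := by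
    rw [mul_smul_comm, ← mul_assoc]; norm_num
  have h3 := (contDiffAt_of_dilations hφ hw (smul_ne_zero ht.1.ne' hv) hn).differentiableAt
    (by simp) |>.hasFDerivAt
  rw [← hl] at h3
  have h4 := h3.comp (7 / 8 : ℂ) ((hasFDerivAt_id (𝕜 := ℝ) (7 / 8 : ℂ)).mul_const (t • (8 / 7 * v)))
  have h5 := h4.unique ((heval (clamp (t • (8 / 7 * v)))).congr_of_eventuallyEq (by
    filter_upwards [hw] with l hl
    rw [← hl, clamp_of_norm_le hz]
    rfl))
  have h6 := congrArg (fun L => L μ) h5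
  have h7 : (t • (8 / 7 * v)) * μ = t • x := by
    simp only [hμ, Complex.real_smul]
    field_simp
  rw [← map_smul, ← h7, ← hl]
  simpa using h6.symm

end Dilation

section FirstOrderSystem

variable {E : Type} [NormedAddCommGroup E] [NormedSpace ℝ E] {r : ℕ}
  [NormedSpace ℂ E] [IsScalarTower ℝ ℂ E] {Ψ : C(E, E →L[ℝ] E)} {q : C(E × E, E)}
  {c : E × (Fin r → E)} {w : C(Disc, E × E)}

theorem fst_eq_of_fpResidual_eq_zero (hw : fpResidual Ψ q ((c, 1), w) = 0) {v : ℂ} (hv : ‖v‖ ≤ 4) :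
    (w (clamp v)).1 =
      c.1 + ∫ t in (0 : ℝ)..1, Ψ (w (clamp (t • v))).1 (v • (w (clamp (t • v))).2) := by
  have h := congrArg Prod.fst (DFunLike.congr_fun hw (clamp v))
  rw [fpResidual_apply, clamp_of_norm_le hv] at h
  simpa [sub_eq_zero] using h

theorem snd_eq_of_fpResidual_eq_zero (hw : fpResidual Ψ q ((c, 1), w) = 0) {v : ℂ} (hv : ‖v‖ ≤ 4) :
    (w (clamp v)).2 = centredPoly c.2 v +
      cauchyTransform (cutoffExtend ((nonlinearPart q).comp (sample ((c, 1), w)))) v := by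
  have h := congrArg Prod.snd (DFunLike.congr_fun hw (clamp v))
  rw [fpResidual_apply, discCauchy_apply, clamp_of_norm_le hv] at h
  simpa [sub_eq_zero] using h

theorem radial_of_fpResidual_eq_zero [CompleteSpace E] (hw : fpResidual Ψ q ((c, 1), w) = 0) {v : ℂ}
    (hv : ‖v‖ < 4) (hd : DifferentiableAt ℝ (fun z => (w (clamp z)).1) v) :
    fderiv ℝ (fun z => (w (clamp z)).1) v v =
      Ψ (w (clamp v)).1 (v • (w (clamp v)).2) := by
  have : SMulCommClass ℝ ℂ E := IsScalarTower.to_smulCommClass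
  set G : ℝ → E := fun t => Ψ (w (clamp (t • v))).1 (v • (w (clamp (t • v))).2) with hG
  have hGc : Continuous G := by
    refine Continuous.clm_apply ?_ ?_ <;> fun_prop
  have h1 : ∀ᶠ s : ℝ in 𝓝 1, (w (clamp (s • v))).1 = c.1 + ∫ t in (0 : ℝ)..s, G t := by
    have hc : ContinuousAt (fun s : ℝ => ‖s • v‖) 1 := by fun_prop
    filter_upwards [hc.eventually_lt_const (by simpa using hv : ‖(1 : ℝ) • v‖ < 4)] with s hs
    rw [fst_eq_of_fpResidual_eq_zero hw hs.le]
    have h := intervalIntegral.smul_integral_comp_mul_left (a := 0) (b := 1) G s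
    rw [mul_zero, mul_one] at h
    rw [← h, ← intervalIntegral.integral_smul]
    simp only [hG, smul_smul, mul_comm s, smul_assoc, map_smul]
  have h2 : HasDerivAt (fun s : ℝ => (w (clamp (s • v))).1) (G 1) 1 :=
    ((intervalIntegral.integral_hasDerivAt_right (hGc.intervalIntegrable _ _)
      hGc.stronglyMeasurable.stronglyMeasurableAtFilter hGc.continuousAt).const_add
        c.1).congr_of_eventuallyEq h1
  have h3 : HasDerivAt (fun s : ℝ => s • v) v 1 := by
    simpa using (hasDerivAt_id (1 : ℝ)).smul_const v
  have h4 : HasDerivAt (fun s : ℝ => (w (clamp (s • v))).1)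
      (fderiv ℝ (fun z => (w (clamp z)).1) v v) 1 :=
    HasFDerivAt.comp_hasDerivAt_of_eq (l := fun z => (w (clamp z)).1) (f := fun s : ℝ => s • v)
      1 hd.hasFDerivAt h3 (by simp)
  simpa [hG] using h4.unique h2

theorem dbar_of_fpResidual_eq_zero [CompleteSpace E] (hq : ContDiff ℝ ∞ q)
    (hw : fpResidual Ψ q ((c, 1), w) = 0)
    (hd : ∀ v : ℂ, v ≠ 0 → ‖v‖ < 2 → ContDiffAt ℝ ∞ (fun z => w (clamp z)) v)
    {v : ℂ} (hv0 : v ≠ 0) (hv : ‖v‖ < 2) :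
    fderiv ℝ (fun z => (w (clamp z)).2) v 1 +
      Complex.I • fderiv ℝ (fun z => (w (clamp z)).2) v Complex.I = q (w (clamp v)) := by
  set g := (nonlinearPart q).comp (sample ((c, 1), w)) with hg
  have h2 : ∀ z : ℂ, ‖z‖ < 2 → cutoffExtend g z = q (w (clamp z)) := fun z hz => by
    rw [cutoffExtend_of_norm_le _ (by linarith)]
    have : innerCutoff (clamp z : ℂ) = 1 := by
      rw [clamp_of_norm_le (by linarith)]
      exact innerCutoff.one_of_mem_closedBall (mem_closedBall_zero_iff.2 hz.le)
    simp [hg, nonlinearPart, this]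
  have hnear : ∀ z : ℂ, ‖z‖ < 2 → ∀ᶠ y : ℂ in 𝓝 z, ‖y‖ < 2 := fun z hz =>
    continuous_norm.continuousAt.eventually_lt_const hz
  have h1 : ∀ᶠ z in 𝓝 v, ContDiffAt ℝ 1 (cutoffExtend g) z := by
    filter_upwards [hnear v hv, isOpen_ne.mem_nhds hv0] with z hz hz0
    have h : ContDiffAt ℝ ∞ (fun z => q (w (clamp z))) z :=
      hq.contDiffAt.comp z (hd z hz0 hz)
    refine (h.congr_of_eventuallyEq ?_).of_le (one_le_two.trans two_le_infty)
    filter_upwards [hnear z hz] with y hy using h2 y hy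
  obtain ⟨D, hD, hD'⟩ := dbar_cauchyTransform (continuous_cutoffExtend g)
    (hasCompactSupport_cutoffExtend g) h1
  have hP : DifferentiableAt ℂ (centredPoly c.2) v := by
    unfold centredPoly
    fun_prop
  have hs : HasFDerivAt (fun z => (w (clamp z)).2)
      ((fderiv ℂ (centredPoly c.2) v).restrictScalars ℝ + D) v := by
    refine (hP.hasFDerivAt.restrictScalars ℝ |>.add hD).congr_of_eventuallyEq ?_
    filter_upwards [hnear v hv] with z hz
    exact snd_eq_of_fpResidual_eq_zero hw (by linarith)
  have hI : fderiv ℂ (centredPoly c.2) v Complex.I = Complex.I • fderiv ℂ (centredPoly c.2) v 1 := by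
    rw [← map_smul, smul_eq_mul, mul_one]
  rw [hs.fderiv, ← h2 v hv, ← hD']
  simp only [add_apply, ContinuousLinearMap.coe_restrictScalars', hI, smul_add, smul_smul, Complex.I_mul_I]
  module

end FirstOrderSystem

section SolutionFamily

variable {E : Type} [NormedAddCommGroup E] [NormedSpace ℝ E] {r : ℕ}
  [NormedSpace ℂ E] [IsScalarTower ℝ ℂ E] {Ψ : C(E, E →L[ℝ] E)} {q : C(E × E, E)}

theorem hasDerivAt_of_fpResidual_eq_zero [CompleteSpace E] (hΨ : ContDiff ℝ ∞ Ψ)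
    (hq : ContDiff ℝ ∞ q) {c : E × (Fin r → E)} {w : C(Disc, E × E)} {φ : ℂ → C(Disc, E × E)}
    (hw : fpResidual Ψ q ((c, 1), w) = 0) (hφ : ContDiffAt ℝ ∞ φ (7 / 8))
    (hwφ : ∀ᶠ l in 𝓝 (7 / 8 : ℂ), ∀ z : Disc, w (clamp (l * z)) = φ l z)
    (hcompat : ∀ (z : Disc) ξ, Ψ (w z).1 (Complex.I • q ((w z).1, ξ)) =
      fderiv ℝ Ψ (w z).1 (Ψ (w z).1 (Complex.I • ξ)) ξ -
        fderiv ℝ Ψ (w z).1 (Ψ (w z).1 ξ) (Complex.I • ξ))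
    {v : ℂ} (hv0 : v ≠ 0) (hv : ‖v‖ < 2) (x : ℂ) :
    fderiv ℝ (fun z => (w (clamp z)).1) v x = Ψ (w (clamp v)).1 (x • (w (clamp v)).2) := by
  have hs : ∀ v : ℂ, v ≠ 0 → ‖v‖ < 2 → ContDiffAt ℝ ∞ (fun z => w (clamp z)) v :=
    fun v hv0 hv => contDiffAt_of_dilations hφ hwφ hv0 (by linarith)
  have hs1 : ∀ v : ℂ, v ≠ 0 → ‖v‖ < 2 → ContDiffAt ℝ ∞ (fun z => (w (clamp z)).1) v :=
    fun v hv0 hv => contDiff_fst.contDiffAt.comp v (hs v hv0 hv)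
  have hs2 : ∀ v : ℂ, v ≠ 0 → ‖v‖ < 2 → ContDiffAt ℝ ∞ (fun z => (w (clamp z)).2) v :=
    fun v hv0 hv => contDiff_snd.contDiffAt.comp v (hs v hv0 hv)
  refine fderiv_eq_of_radial (Ψ := Ψ) (u := fun z => (w (clamp z)).1)
    (ξ := fun z => (w (clamp z)).2) hΨ (by fun_prop) (by fun_prop) hs1 hs2
    (fun v hv0 hv => radial_of_fpResidual_eq_zero hw (by linarith)
      ((hs1 v hv0 hv).differentiableAt (by simp))) ?_ ?_ hv0 hv x
  · intro v hv0 hv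
    have h1 := dbar_of_fpResidual_eq_zero hq hw hs hv0 hv
    have h2 := hcompat (clamp v) (w (clamp v)).2
    rw [Prod.mk.eta, ← h1] at h2
    rw [← neg_sub (fderiv ℝ Ψ _ (Ψ _ (Complex.I • _)) _), ← h2, ← map_neg]
    congr 1
    rw [smul_add, smul_smul, Complex.I_mul_I]
    module
  · intro v y hv0 hv
    have h := tendsto_smul_fderiv_of_dilations hφ hwφ hv0 (by linarith) y
    have h' : Tendsto (fun t : ℝ => (t • fderiv ℝ (fun v => w (clamp v)) (t • v) y).1)
        (𝓝[>] 0) (𝓝 0) := (continuous_fst.tendsto (0 : E × E)).comp h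
    refine h'.congr' ?_
    have hle : ∀ᶠ t : ℝ in 𝓝[>] 0, ‖t • v‖ < 2 := by
      have hc : ContinuousAt (fun s : ℝ => ‖s • v‖) 0 := by fun_prop
      exact (hc.eventually_lt_const (by simp)).filter_mono nhdsWithin_le_nhds
    filter_upwards [hle, self_mem_nhdsWithin] with t ht ht0
    have hd := ((hs (t • v) (smul_ne_zero ht0.ne' hv0) ht).differentiableAt (by simp)).hasFDerivAt
    have h3 : HasFDerivAt (fun z => (w (clamp z)).1) _ (t • v) := hd.fst
    rw [h3.fderiv]
    rfl

theorem integral_smul_centredPoly [CompleteSpace E] (l : ℂ) (c : Fin r → E) :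
    ∫ t in (0 : ℝ)..1, l • centredPoly c (l * t) = ∑ j : Fin r,
      (((l - 7 / 8) ^ ((j : ℕ) + 1) - (-(7 / 8)) ^ ((j : ℕ) + 1)) / ((j : ℕ) + 1)) • c j := by
  have : SMulCommClass ℝ ℂ E := IsScalarTower.to_smulCommClass
  simp only [centredPoly, Finset.smul_sum]
  rw [intervalIntegral.integral_finsetSum fun j _ => Continuous.intervalIntegrable (by fun_prop) _ _]
  refine Finset.sum_congr rfl fun j _ => ?_
  have h0 : ((j : ℕ) + 1 : ℂ) ≠ 0 := by exact_mod_cast (j : ℕ).succ_ne_zero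
  have hd : ∀ t : ℝ, HasDerivAt (fun t : ℝ => ((l * t - 7 / 8) ^ ((j : ℕ) + 1) / ((j : ℕ) + 1)) • c j)
      (l • (l * t - 7 / 8) ^ (j : ℕ) • c j) t := fun t => by
    have h1 : HasDerivAt (fun t : ℂ => (l * t - 7 / 8) ^ ((j : ℕ) + 1) / ((j : ℕ) + 1))
        (l * (l * t - 7 / 8) ^ (j : ℕ)) (t : ℂ) := by
      have h2 : HasDerivAt (fun t : ℂ => l * t - 7 / 8) l (t : ℂ) := by
        simpa using ((hasDerivAt_id (t : ℂ)).const_mul l).sub_const (7 / 8)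
      refine ((h2.fun_pow ((j : ℕ) + 1)).div_const ((j : ℕ) + 1 : ℂ)).congr_deriv ?_
      rw [Nat.add_sub_cancel, Nat.cast_succ]
      field_simp
    rw [smul_smul]
    exact (h1.comp_ofReal).smul_const (c j)
  rw [intervalIntegral.integral_eq_sub_of_hasDerivAt (fun t _ => hd t)
    (Continuous.intervalIntegrable (by fun_prop) _ _), ← sub_smul]
  congr 1
  push_cast
  ring

/-- A smooth family of solutions of `du = Ψ u (· • ξ)` near `7 / 8`, depending on the parameters of
the fixed point equation, whose derivative at the trivial solution is explicit. -/
theorem exists_smooth_family [CompleteSpace E] (hΨ : ContDiff ℝ ∞ Ψ) (hq : ContDiff ℝ ∞ q)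
    (hΨ0 : Ψ 0 = ContinuousLinearMap.id ℝ E)
    (hq2 : ∀ (t : ℝ) u ξ, q (u, t • ξ) = t ^ 2 • q (u, ξ))
    (hcompat : ∀ᶠ u in 𝓝 (0 : E), ∀ ξ, Ψ u (Complex.I • q (u, ξ)) =
      fderiv ℝ Ψ u (Ψ u (Complex.I • ξ)) ξ - fderiv ℝ Ψ u (Ψ u ξ) (Complex.I • ξ)) :
    ∃ f : Param E r → E,
      (∀ᶠ a in 𝓝 ((0, 7 / 8) : Param E r), ContDiffAt ℝ ∞ f a ∧
        ∃ ξ, ∀ x : ℂ, fderiv ℝ (fun z => f (a.1, z)) a.2 x = Ψ (f a) (x • ξ)) ∧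
      ∀ᶠ l in 𝓝 (7 / 8 : ℂ), f (0, l) = 0 ∧ ∀ δ : E × (Fin r → E), fderiv ℝ f (0, l) (δ, 0) =
        δ.1 + ∑ j : Fin r,
          (((l - 7 / 8) ^ ((j : ℕ) + 1) - (-(7 / 8)) ^ ((j : ℕ) + 1)) / ((j : ℕ) + 1)) • δ.2 j := by
  obtain ⟨𝒰, W, hW0, hW, h𝒰, h𝒰0⟩ := exists_solution_family (r := r) Ψ q hΨ hq hΨ0 hq2
  set e : C(Disc, E × E) →L[ℝ] E :=
    ContinuousLinearMap.fst ℝ E E ∘L ContinuousMap.evalCLM ℝ (clamp 1) with he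
  have hclamp1 : ((clamp 1 : Disc) : ℂ) = 1 := clamp_of_norm_le (by norm_num)
  set f : Param E r → E := fun a => (W a.1 (clamp a.2)).1 with hf
  have hfe : ∀ᶠ a in 𝓝 ((0, 7 / 8) : Param E r), f =ᶠ[𝓝 a] fun a => e (𝒰 a) := by
    filter_upwards [h𝒰.eventually_nhds] with a ha
    filter_upwards [ha] with b hb
    have := hb.2.2 (clamp 1)
    rw [hclamp1, mul_one] at this
    simp [hf, this, he]
  refine ⟨f, ?_, ?_⟩
  · have hc1 : ∀ᶠ c in 𝓝 (0 : E × (Fin r → E)), ∀ᶠ l in 𝓝 (7 / 8 : ℂ),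
        ContDiffAt ℝ ∞ 𝒰 (c, l) ∧ fpResidual Ψ q ((c, l), 𝒰 (c, l)) = 0 ∧
          ∀ z : Disc, W c (clamp (l * z)) = 𝒰 (c, l) z := h𝒰.curry_nhds
    have hc2 : ∀ᶠ c in 𝓝 (0 : E × (Fin r → E)), ∀ (z : Disc) ξ,
        Ψ (W c z).1 (Complex.I • q ((W c z).1, ξ)) =
          fderiv ℝ Ψ (W c z).1 (Ψ (W c z).1 (Complex.I • ξ)) ξ -
            fderiv ℝ Ψ (W c z).1 (Ψ (W c z).1 ξ) (Complex.I • ξ) := by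
      obtain ⟨ρ, hρ, h⟩ := Metric.eventually_nhds_iff.1 hcompat
      filter_upwards [hW0.eventually (Metric.ball_mem_nhds 0 hρ)] with c hc z
      refine h ?_
      rw [dist_zero_right]
      exact ((norm_fst_le _).trans (ContinuousMap.norm_coe_le_norm (W c) z)).trans_lt
        (mem_ball_zero_iff.1 hc)
    have hc : ∀ᶠ c in 𝓝 (0 : E × (Fin r → E)), ∀ v : ℂ, v ≠ 0 → ‖v‖ < 2 → ∀ x : ℂ,
        fderiv ℝ (fun z => (W c (clamp z)).1) v x =
          Ψ (W c (clamp v)).1 (x • (W c (clamp v)).2) := by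
      filter_upwards [hc1, hc2, hW] with c h1 h2 h3 v hv0 hv x
      refine hasDerivAt_of_fpResidual_eq_zero hΨ hq h3 (φ := fun l => 𝒰 (c, l)) ?_
        (h1.mono fun l hl => hl.2.2) h2 hv0 hv x
      exact ContDiffAt.comp (g := 𝒰) (f := fun l : ℂ => (c, l)) (7 / 8) h1.self_of_nhds.1
        (by fun_prop)
    have hc' : ∀ᶠ a in 𝓝 ((0, 7 / 8) : Param E r), ∀ v : ℂ, v ≠ 0 → ‖v‖ < 2 → ∀ x : ℂ,
        fderiv ℝ (fun z => (W a.1 (clamp z)).1) v x =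
          Ψ (W a.1 (clamp v)).1 (x • (W a.1 (clamp v)).2) :=
      (continuous_fst.tendsto ((0, 7 / 8) : Param E r)).eventually hc
    have hne : ∀ᶠ a in 𝓝 ((0, 7 / 8) : Param E r), a.2 ≠ 0 :=
      continuous_snd.continuousAt.eventually_ne (by norm_num)
    have hlt : ∀ᶠ a in 𝓝 ((0, 7 / 8) : Param E r), ‖a.2‖ < 2 :=
      continuous_snd.norm.continuousAt.eventually_lt_const (by norm_num)
    filter_upwards [hfe, h𝒰, hc', hne, hlt] with a h1 h2 h3 h4 h5
    refine ⟨?_, (W a.1 (clamp a.2)).2, h3 a.2 h4 h5⟩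
    exact (e.contDiff.contDiffAt.comp a h2.1).congr_of_eventuallyEq h1
  · have hι : Tendsto (fun l : ℂ => ((0, l) : Param E r)) (𝓝 (7 / 8)) (𝓝 (0, 7 / 8)) :=
      (Continuous.prodMk_right _).tendsto _
    have h𝒰' : ∀ᶠ l in 𝓝 (7 / 8 : ℂ), ∀ᶠ a in 𝓝 ((0, l) : Param E r), ContDiffAt ℝ ∞ 𝒰 a ∧
        fpResidual Ψ q (a, 𝒰 a) = 0 :=
      hι.eventually (h𝒰.mono fun a h => ⟨h.1, h.2.1⟩).eventually_nhds
    filter_upwards [hι.eventually hfe, h𝒰', h𝒰0] with l h1 h2 h3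
    have hD : HasFDerivAt 𝒰 (fderiv ℝ 𝒰 (0, l)) (0, l) :=
      (h2.self_of_nhds.1.differentiableAt (by simp)).hasFDerivAt
    refine ⟨by simpa [h3] using h1.self_of_nhds, fun δ => ?_⟩
    obtain ⟨L, hL, hL'⟩ := hasFDerivAt_fpResidual (r := r) Ψ q hΨ hq hΨ0 hq2 l
    have hfD : HasFDerivAt f (e ∘L fderiv ℝ 𝒰 (0, l)) (0, l) :=
      (HasFDerivAt.comp (g := e) _ (ContinuousLinearMap.hasFDerivAt _) hD).congr_of_eventuallyEq h1
    have hcomp : HasFDerivAt (fun a : Param E r => fpResidual Ψ q (a, 𝒰 a))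
        (L ∘L (ContinuousLinearMap.id ℝ (Param E r)).prod (fderiv ℝ 𝒰 (0, l))) (0, l) :=
      HasFDerivAt.comp (g := fpResidual Ψ q) (f := fun a : Param E r => (a, 𝒰 a)) (0, l)
        (by rwa [h3]) ((hasFDerivAt_id _).prodMk hD)
    have hzero : HasFDerivAt (fun a : Param E r => fpResidual Ψ q (a, 𝒰 a))
        (0 : Param E r →L[ℝ] C(Disc, E × E)) (0, l) :=
      (hasFDerivAt_const (0 : C(Disc, E × E)) _).congr_of_eventuallyEq (h2.mono fun a h => h.2)
    have hu := DFunLike.congr_fun (hcomp.unique hzero) (δ, 0)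
    set h := fderiv ℝ 𝒰 (0, l) (δ, 0) with hh
    have hu' : ∀ z : Disc, L ((δ, 0), h) z = 0 := fun z => DFunLike.congr_fun hu z
    simp only [hL', Prod.mk_eq_zero, sub_eq_zero] at hu'
    have h4 := (hu' (clamp 1)).1
    rw [hclamp1] at h4
    rw [hfD.fderiv]
    change (h (clamp 1)).1 = _
    rw [eq_add_of_sub_eq' h4, ← integral_smul_centredPoly]
    congr 1
    refine intervalIntegral.integral_congr fun t ht => ?_
    rw [uIcc_of_le zero_le_one] at ht
    simp only [(hu' _).2, one_mul]
    rw [clamp_of_norm_le]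
    · simp
    · rw [norm_smul, Real.norm_of_nonneg ht.1, norm_one]
      linarith [ht.2]

end SolutionFamily

section Jets

variable {E : Type*} [NormedAddCommGroup E] [NormedSpace ℝ E]

theorem Filter.EventuallyEq.iterate_pX {u v : ℂ → E} {z : ℂ} (h : u =ᶠ[𝓝 z] v) (k : ℕ) :
    pX^[k] u =ᶠ[𝓝 z] pX^[k] v := by
  induction k with
  | zero => exact h
  | succ k ih =>
    simp only [Function.iterate_succ_apply']
    exact ih.fderiv.fun_comp fun L => L 1

theorem iterate_pX_zero (k : ℕ) : pX^[k] (0 : ℂ → E) = 0 := by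
  induction k with
  | zero => rfl
  | succ k ih =>
    rw [Function.iterate_succ_apply', ih]
    ext z
    simp [pX]

theorem fderiv_comp_affine (u : ℂ → E) (t : ℝ) (d z : ℂ) :
    fderiv ℝ (fun z => u (t • z + d)) z = t • fderiv ℝ u (t • z + d) := by
  rw [fderiv_comp_smul (f := fun y => u (y + d)), fderiv_comp_add_right]

theorem iterate_pX_comp_affine (u : ℂ → E) (t : ℝ) (d : ℂ) (k : ℕ) :
    pX^[k] (fun z => u (t • z + d)) = fun z => t ^ k • (pX^[k] u) (t • z + d) := by
  induction k with
  | zero => simp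
  | succ k ih =>
    simp only [Function.iterate_succ_apply']
    rw [ih]
    ext z
    have h : fderiv ℝ (fun z => t ^ k • pX^[k] u (t • z + d)) z =
        t ^ k • fderiv ℝ (fun z => pX^[k] u (t • z + d)) z :=
      congrFun (fderiv_const_smul_field (t ^ k)) z
    rw [pX, h, fderiv_comp_affine]
    simp [pX, pow_succ, smul_smul]

variable {C : Type*} [NormedAddCommGroup C] [NormedSpace ℝ C] {f : C × ℂ → E} {a₀ : C × ℂ}

/-- The partial derivative in the `x`-direction of the second variable. -/
noncomputable def pXSnd (f : C × ℂ → E) (a : C × ℂ) : E := fderiv ℝ f a (0, 1)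

theorem eventually_contDiffAt_iterate_pXSnd (hf : ∀ᶠ a in 𝓝 a₀, ContDiffAt ℝ ∞ f a) (k : ℕ) :
    ∀ᶠ a in 𝓝 a₀, ContDiffAt ℝ ∞ (pXSnd^[k] f) a := by
  induction k with
  | zero => exact hf
  | succ k ih =>
    rw [Function.iterate_succ_apply']
    filter_upwards [ih] with a ha
    exact (ha.fderiv_right (by simp)).clm_apply contDiffAt_const

theorem eventually_iterate_pX_eq (hf : ∀ᶠ a in 𝓝 a₀, ContDiffAt ℝ ∞ f a) (k : ℕ) :
    ∀ᶠ a in 𝓝 a₀, (pX^[k] fun z => f (a.1, z)) a.2 = pXSnd^[k] f a := by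
  induction k with
  | zero => simp
  | succ k ih =>
    simp only [Function.iterate_succ_apply']
    filter_upwards [ih.eventually_nhds, eventually_contDiffAt_iterate_pXSnd hf k] with a ha hs
    have h1 : (pX^[k] fun z => f (a.1, z)) =ᶠ[𝓝 a.2] fun z => pXSnd^[k] f (a.1, z) :=
      (Continuous.prodMk_right a.1).continuousAt.eventually ha
    have h2 : HasFDerivAt (fun z => pXSnd^[k] f (a.1, z)) _ a.2 :=
      HasFDerivAt.comp (g := pXSnd^[k] f) (f := fun z : ℂ => (a.1, z)) a.2
        (hs.differentiableAt (by simp)).hasFDerivAt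
        ((hasFDerivAt_const a.1 a.2).prodMk (hasFDerivAt_id a.2))
    rw [pX, h1.fderiv_eq, h2.fderiv]
    simp [pXSnd]

theorem eventually_fderiv_iterate_pXSnd {c₀ : C} {b : ℂ}
    (hf : ∀ᶠ a in 𝓝 (c₀, b), ContDiffAt ℝ ∞ f a) (δ : C) (k : ℕ) :
    ∀ᶠ z in 𝓝 b, fderiv ℝ (pXSnd^[k] f) (c₀, z) (δ, 0) =
      (pX^[k] fun z => fderiv ℝ f (c₀, z) (δ, 0)) z := by
  induction k with
  | zero => simp
  | succ k ih =>
    simp only [Function.iterate_succ_apply']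
    have hs : ∀ᶠ z in 𝓝 b, ContDiffAt ℝ ∞ (pXSnd^[k] f) (c₀, z) :=
      (Continuous.prodMk_right c₀).continuousAt.eventually
        (eventually_contDiffAt_iterate_pXSnd hf k)
    filter_upwards [ih.eventually_nhds, hs] with z hz hs
    have h1 : (pX^[k] fun z => fderiv ℝ f (c₀, z) (δ, 0)) =ᶠ[𝓝 z]
      fun z => fderiv ℝ (pXSnd^[k] f) (c₀, z) (δ, 0) := hz.mono fun _ h => h.symm
    have hD : HasFDerivAt (fderiv ℝ (pXSnd^[k] f)) (fderiv ℝ (fderiv ℝ (pXSnd^[k] f)) (c₀, z))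
        (c₀, z) :=
      ((hs.fderiv_right (m := ∞) (by simp)).differentiableAt (by simp)).hasFDerivAt
    have h2 : HasFDerivAt (fun z => fderiv ℝ (pXSnd^[k] f) (c₀, z)) _ z :=
      HasFDerivAt.comp (g := fderiv ℝ (pXSnd^[k] f)) (f := fun z : ℂ => (c₀, z)) z hD
        ((hasFDerivAt_const c₀ z).prodMk (hasFDerivAt_id z))
    have h3 : HasFDerivAt (pXSnd (pXSnd^[k] f)) _ (c₀, z) :=
      hD.clm_apply (hasFDerivAt_const ((0 : C), (1 : ℂ)) _)
    have h4 : HasFDerivAt (fun z => fderiv ℝ (pXSnd^[k] f) (c₀, z) (δ, 0)) _ z :=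
      h2.clm_apply (hasFDerivAt_const (δ, (0 : ℂ)) _)
    rw [pX, h1.fderiv_eq, h3.fderiv, h4.fderiv]
    have hsymm := (hs.isSymmSndFDerivAt (by simpa using two_le_infty)).eq (δ, 0) (0, 1)
    simpa using hsymm

end Jets

section JetMap

variable {E : Type} [NormedAddCommGroup E] [NormedSpace ℝ E] {r : ℕ}
  [NormedSpace ℂ E] [IsScalarTower ℝ ℂ E]

theorem HasDerivAt.pX_eq {u : ℂ → E} {u' : E} {z : ℂ} (h : HasDerivAt u u' z) : pX u z = u' := by
  rw [pX, (h.hasFDerivAt.restrictScalars ℝ).fderiv]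
  simp

theorem pX_primitive_centredPoly (p : E) (c : Fin r → E) :
    pX (fun z : ℂ => p + ∑ j : Fin r,
      (((z - 7 / 8) ^ ((j : ℕ) + 1) - (-(7 / 8)) ^ ((j : ℕ) + 1)) / ((j : ℕ) + 1)) • c j) =
        centredPoly c := by
  ext z
  refine (HasDerivAt.const_add p (HasDerivAt.fun_sum fun j _ => ?_)).pX_eq
  have h0 : ((j : ℕ) + 1 : ℂ) ≠ 0 := by exact_mod_cast (j : ℕ).succ_ne_zero
  refine HasDerivAt.smul_const ?_ (c j)
  refine ((((hasDerivAt_id' z).sub_const (7 / 8)).fun_pow ((j : ℕ) + 1)).sub_const _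
    |>.div_const ((j : ℕ) + 1 : ℂ)).congr_deriv ?_
  rw [Nat.add_sub_cancel, Nat.cast_succ]
  field_simp

theorem iterate_pX_centredPoly (c : Fin r → E) (k : ℕ) :
    pX^[k] (centredPoly c) = fun z => ∑ j : Fin r,
      ((Nat.descFactorial j k : ℂ) * (z - 7 / 8) ^ ((j : ℕ) - k)) • c j := by
  induction k with
  | zero => ext z; simp [centredPoly]
  | succ k ih =>
    rw [Function.iterate_succ_apply', ih]
    ext z
    refine (HasDerivAt.fun_sum fun j _ => ?_).pX_eq
    refine HasDerivAt.smul_const ?_ (c j)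
    refine (((hasDerivAt_id' z).sub_const (7 / 8)).fun_pow ((j : ℕ) - k) |>.const_mul
      (Nat.descFactorial j k : ℂ)).congr_deriv ?_
    rw [Nat.descFactorial_succ, Nat.sub_sub]
    push_cast
    ring

theorem iterate_pX_centredPoly_center (c : Fin r → E) (k : Fin r) :
    (pX^[k] (centredPoly c)) (7 / 8) = (Nat.factorial k : ℂ) • c k := by
  rw [iterate_pX_centredPoly]
  dsimp only
  rw [Finset.sum_eq_single k]
  · simp [Nat.descFactorial_self]
  · intro j _ hj
    rcases lt_or_gt_of_ne hj with h | h
    · rw [Nat.descFactorial_eq_zero_iff_lt.2 h]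
      simp
    · rw [sub_self, zero_pow (Nat.sub_ne_zero_of_lt h)]
      simp
  · simp

/-- All small jets are attained by a family whose derivative at the trivial member is given by
arbitrary polynomials. -/
theorem eventually_exists_jet [CompleteSpace E] {f : Param E r → E}
    (hf : ∀ᶠ a in 𝓝 ((0, 7 / 8) : Param E r), ContDiffAt ℝ ∞ f a)
    (hD : ∀ᶠ l in 𝓝 (7 / 8 : ℂ), f (0, l) = 0 ∧
      ∀ δ : E × (Fin r → E), fderiv ℝ f (0, l) (δ, 0) = δ.1 + ∑ j : Fin r,
        (((l - 7 / 8) ^ ((j : ℕ) + 1) - (-(7 / 8)) ^ ((j : ℕ) + 1)) / ((j : ℕ) + 1)) • δ.2 j)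
    {P : E × (Fin r → E) → Prop} (hP : ∀ᶠ c in 𝓝 0, P c) :
    ∀ᶠ t in 𝓝 (0 : E × (Fin r → E)), ∃ c, P c ∧ f (c, 7 / 8) = t.1 ∧
      ∀ k : Fin r, (pX^[(k : ℕ) + 1] fun z => f (c, z)) (7 / 8) = t.2 k := by
  set G : E × (Fin r → E) → E × (Fin r → E) := fun c =>
    (f (c, 7 / 8), fun k => pXSnd^[(k : ℕ) + 1] f (c, 7 / 8)) with hG
  have hs : ∀ k, ContDiffAt ℝ ∞ (pXSnd^[k] f) (0, 7 / 8) := fun k =>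
    (eventually_contDiffAt_iterate_pXSnd hf k).self_of_nhds
  have hι : HasFDerivAt (fun c : E × (Fin r → E) => ((c, 7 / 8) : Param E r))
      (ContinuousLinearMap.inl ℝ (E × (Fin r → E)) ℂ) 0 :=
    hasFDerivAt_prodMk_left 0 (7 / 8)
  have hιs : ContDiff ℝ ∞ (fun c : E × (Fin r → E) => ((c, 7 / 8) : Param E r)) := by fun_prop
  have hsι : ∀ k, ContDiffAt ℝ ∞ (fun c : E × (Fin r → E) => pXSnd^[k] f (c, 7 / 8)) 0 := fun k =>
    ContDiffAt.comp (g := pXSnd^[k] f) 0 (hs k) hιs.contDiffAt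
  have hGs : ContDiffAt ℝ ∞ G 0 := (hsι 0).prodMk (contDiffAt_pi.2 fun k => hsι (k + 1))
  have hd : ∀ k, HasFDerivAt (fun c : E × (Fin r → E) => pXSnd^[k] f (c, 7 / 8))
      (fderiv ℝ (pXSnd^[k] f) (0, 7 / 8) ∘L ContinuousLinearMap.inl ℝ (E × (Fin r → E)) ℂ) 0 :=
    fun k => HasFDerivAt.comp (g := pXSnd^[k] f) 0
      ((hs k).differentiableAt (by simp)).hasFDerivAt hι
  have hGd := (hd 0).prodMk (hasFDerivAt_pi.2 fun k : Fin r => hd (k + 1))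
  have hjet : ∀ (k : ℕ) δ, fderiv ℝ (pXSnd^[k] f) (0, 7 / 8) (δ, 0) =
      (pX^[k] fun z : ℂ => δ.1 + ∑ j : Fin r,
        (((z - 7 / 8) ^ ((j : ℕ) + 1) - (-(7 / 8)) ^ ((j : ℕ) + 1)) / ((j : ℕ) + 1)) • δ.2 j)
          (7 / 8) := fun k δ => by
    rw [(eventually_fderiv_iterate_pXSnd hf δ k).self_of_nhds]
    have h : (fun z => fderiv ℝ f (0, z) (δ, 0)) =ᶠ[𝓝 (7 / 8)] _ := hD.mono fun l hl => hl.2 δ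
    exact (h.iterate_pX k).self_of_nhds
  have hG0 : G 0 = 0 := by
    have h : ∀ k, pXSnd^[k] f (0, 7 / 8) = 0 := fun k => by
      rw [← (eventually_iterate_pX_eq hf k).self_of_nhds]
      have h : (fun z => f (0, z)) =ᶠ[𝓝 (7 / 8)] 0 := hD.mono fun l hl => hl.1
      rw [(h.iterate_pX k).self_of_nhds, iterate_pX_zero]
      rfl
    exact Prod.ext (h 0) (funext fun k => h (k + 1))
  have hmap := (hGs.hasStrictFDerivAt' hGd (by simp)).map_nhds_eq_of_surj (by
    refine LinearMap.range_eq_top.2 fun t => ?_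
    set d : Fin r → E := fun k => (Nat.factorial k : ℂ)⁻¹ • t.2 k with hd
    refine ⟨(t.1 - ∑ j : Fin r, ((((7 / 8 : ℂ) - 7 / 8) ^ ((j : ℕ) + 1) -
      (-(7 / 8)) ^ ((j : ℕ) + 1)) / ((j : ℕ) + 1)) • d j, d), Prod.ext ?_ (funext fun k => ?_)⟩
    · refine (hjet 0 _).trans ?_
      rw [Function.iterate_zero_apply]
      exact sub_add_cancel _ _
    · refine (hjet (k + 1) _).trans ?_
      rw [Function.iterate_succ_apply, pX_primitive_centredPoly, iterate_pX_centredPoly_center, hd]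
      simp [smul_smul, Nat.factorial_ne_zero])
  have hιt : Tendsto (fun c : E × (Fin r → E) => ((c, 7 / 8) : Param E r)) (𝓝 0)
      (𝓝 (0, 7 / 8)) := hιs.continuous.tendsto _
  have hall : ∀ᶠ c in 𝓝 (0 : E × (Fin r → E)), P c ∧ ∀ k : Fin r,
      (pX^[(k : ℕ) + 1] fun z => f (c, z)) (7 / 8) = pXSnd^[(k : ℕ) + 1] f (c, 7 / 8) :=
    hP.and (eventually_all.2 fun k => hιt.eventually (eventually_iterate_pX_eq hf _))
  have himg := image_mem_map (m := G) hall
  rw [hmap, hG0] at himg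
  filter_upwards [himg] with t ⟨c, ⟨hc, hk⟩, hct⟩
  refine ⟨c, hc, congrArg Prod.fst hct, fun k => ?_⟩
  rw [hk k, ← hct]

end JetMap

section AlmostComplexStructure

variable {E : Type} [NormedAddCommGroup E] [NormedSpace ℝ E] [FiniteDimensional ℝ E]

theorem exists_contDiff_local_inverse {Ψ : E → E →L[ℝ] E} (hΨ : ContDiff ℝ ∞ Ψ)
    (hΨ0 : Ψ 0 = ContinuousLinearMap.id ℝ E) :
    ∃ M : E → E →L[ℝ] E, ContDiff ℝ ∞ M ∧
      ∀ᶠ p in 𝓝 0, Ψ p ∘L M p = ContinuousLinearMap.id ℝ E := by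
  have : CompleteSpace E := FiniteDimensional.complete ℝ E
  have hunit : ∀ᶠ p in 𝓝 0, IsUnit (Ψ p) :=
    hΨ.continuous.continuousAt.eventually (Units.isOpen.mem_nhds (by rw [hΨ0]; exact isUnit_one))
  obtain ⟨ρ, hρ, hρu⟩ := Metric.eventually_nhds_iff_ball.1 hunit
  let χ : ContDiffBump (0 : E) := ⟨ρ / 3, ρ / 2, by linarith, by linarith⟩
  refine ⟨fun p => χ p • Ring.inverse (Ψ p), ?_, ?_⟩
  · rw [contDiff_iff_contDiffAt]
    intro p
    by_cases hp : p ∈ Metric.ball (0 : E) ρ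
    · obtain ⟨v, hv⟩ := hρu p hp
      have h : ContDiffAt ℝ ∞ Ring.inverse (Ψ p) := hv ▸ contDiffAt_ringInverse ℝ v
      exact χ.contDiff.contDiffAt.smul (h.comp p hΨ.contDiffAt)
    · have hlt : ρ / 2 < dist p 0 := by
        rw [Metric.mem_ball, not_lt] at hp
        linarith
      refine contDiffAt_const (c := (0 : E →L[ℝ] E)) |>.congr_of_eventuallyEq ?_
      have hc : ContinuousAt (fun y : E => dist y 0) p := by fun_prop
      filter_upwards [hc.eventually_const_lt hlt] with y hy
      rw [χ.zero_of_le_dist hy.le, zero_smul]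
  · filter_upwards [Metric.ball_mem_nhds (0 : E) χ.rIn_pos] with p hp
    have hu : IsUnit (Ψ p) := hρu p (Metric.ball_subset_ball (by change ρ / 3 ≤ ρ; linarith) hp)
    rw [χ.one_of_mem_closedBall (Metric.ball_subset_closedBall hp), one_smul]
    exact Ring.mul_inverse_cancel _ hu

variable [NormedSpace ℂ E] [IsScalarTower ℝ ℂ E]

/-- An almost complex structure that is standard at `0` is intertwined with multiplication by `i` by
a smooth family of endomorphisms `Ψ`, and the compatibility condition for `du = Ψ u (· • ξ)` can be
solved for the antiholomorphic derivative of `ξ`. -/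
theorem exists_intertwiner {J : E → E →L[ℝ] E} (hJ : ContDiff ℝ ∞ J)
    (hJsq : ∀ p v, J p (J p v) = -v) (hJ0 : ∀ v, J 0 v = Complex.I • v) :
    ∃ (Ψ : C(E, E →L[ℝ] E)) (q : C(E × E, E)), ContDiff ℝ ∞ Ψ ∧ ContDiff ℝ ∞ q ∧
      Ψ 0 = ContinuousLinearMap.id ℝ E ∧
      (∀ (t : ℝ) u ξ, q (u, t • ξ) = t ^ 2 • q (u, ξ)) ∧
      (∀ᶠ u in 𝓝 (0 : E), ∀ ξ, Ψ u (Complex.I • q (u, ξ)) =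
        fderiv ℝ Ψ u (Ψ u (Complex.I • ξ)) ξ - fderiv ℝ Ψ u (Ψ u ξ) (Complex.I • ξ)) ∧
      ∀ p v, Ψ p v + J p (Ψ p (Complex.I • v)) = 0 := by
  have : SMulCommClass ℝ ℂ E := IsScalarTower.to_smulCommClass
  let i : E →L[ℝ] E := ContinuousLinearMap.lsmul ℝ ℂ Complex.I
  let Ψ : E → E →L[ℝ] E := fun p => (2⁻¹ : ℝ) • (ContinuousLinearMap.id ℝ E - J p ∘L i)
  have hΨa : ∀ p v, Ψ p v = (2⁻¹ : ℝ) • (v - J p (Complex.I • v)) := fun _ _ => rfl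
  have hΨ : ContDiff ℝ ∞ Ψ :=
    (contDiff_const.sub (hJ.clm_comp contDiff_const)).const_smul _
  have hII : ∀ v : E, Complex.I • Complex.I • v = -v := fun v => by
    rw [smul_smul, Complex.I_mul_I, neg_one_smul]
  have hΨ0 : Ψ 0 = ContinuousLinearMap.id ℝ E := by
    ext v
    rw [hΨa, hJ0, hII, ContinuousLinearMap.id_apply]
    module
  obtain ⟨M, hM, hΨM⟩ := exists_contDiff_local_inverse hΨ hΨ0
  let q : E × E → E := fun x => -(Complex.I • M x.1
    (fderiv ℝ Ψ x.1 (Ψ x.1 (Complex.I • x.2)) x.2 - fderiv ℝ Ψ x.1 (Ψ x.1 x.2) (Complex.I • x.2)))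
  have hΨ' : ContDiff ℝ ∞ (fderiv ℝ Ψ) := hΨ.fderiv_right (by simp)
  have hq : ContDiff ℝ ∞ q := by
    have hI : ContDiff ℝ ∞ fun x : E × E => Complex.I • x.2 := by fun_prop
    have hD : ContDiff ℝ ∞ fun x : E × E => fderiv ℝ Ψ x.1 := hΨ'.comp contDiff_fst
    have hP : ContDiff ℝ ∞ fun x : E × E => Ψ x.1 := hΨ.comp contDiff_fst
    exact (contDiff_const.smul ((hM.comp contDiff_fst).clm_apply
      (((hD.clm_apply (hP.clm_apply hI)).clm_apply contDiff_snd).sub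
        ((hD.clm_apply (hP.clm_apply contDiff_snd)).clm_apply hI)))).neg
  refine ⟨⟨Ψ, hΨ.continuous⟩, ⟨q, hq.continuous⟩, hΨ, hq, hΨ0, fun t u ξ => ?_, ?_, fun p v => ?_⟩
  · simp only [ContinuousMap.coe_mk, q, smul_comm Complex.I t, map_smul, smul_apply,
      ← smul_sub, smul_neg, smul_smul, pow_two]
    rw [smul_comm]
  · filter_upwards [hΨM] with u hu ξ
    simp only [ContinuousMap.coe_mk, q, smul_neg, hII, neg_neg]
    exact DFunLike.congr_fun hu _
  · simp only [ContinuousMap.coe_mk, hΨa, hII, map_neg, map_smul, map_sub, hJsq]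
    module

end AlmostComplexStructure

/-- if `J` is an almost complex structure on `ℝ^{2n}` with `J(0) = i`,
then there is an open neighbourhood `V` of `0` such that for every `z₀ ∈ ℂ`, `p ∈ V`
and vectors `a₁, …, a_r`, there is a `J`-holomorphic map `u` on a small disc about `z₀`
with `u(z₀) = p` and `∂ₓ^ℓ u(z₀) = a_ℓ` for `ℓ = 1, …, r`. -/
theorem stmt0 (n r : ℕ) (hn : 1 ≤ n)
    (J : (Fin n → ℂ) → ((Fin n → ℂ) →L[ℝ] (Fin n → ℂ)))
    (hJsmooth : ContDiff ℝ (⊤ : ℕ∞) J)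
    (hJsq : ∀ p, (J p).comp (J p) = - ContinuousLinearMap.id ℝ (Fin n → ℂ))
    (hJ0 : J 0 = Jstd n) :
    ∃ V : Set (Fin n → ℂ), IsOpen V ∧ (0 : Fin n → ℂ) ∈ V ∧
      ∀ (z₀ : ℂ), ∀ p ∈ V, ∀ a : Fin r → (Fin n → ℂ),
        ∃ (ε : ℝ) (u : ℂ → (Fin n → ℂ)), 0 < ε ∧
          ContDiffOn ℝ (⊤ : ℕ∞) u (Metric.ball z₀ ε) ∧
          (∀ z ∈ Metric.ball z₀ ε, pX u z + J (u z) (pY u z) = 0) ∧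
          u z₀ = p ∧
          ∀ ℓ : Fin r, (pX^[(ℓ : ℕ) + 1] u) z₀ = a ℓ := by
  obtain ⟨Ψ, q, hΨ, hq, hΨ0, hq2, hcompat, hΨJ⟩ := exists_intertwiner hJsmooth
    (fun p v => DFunLike.congr_fun (hJsq p) v) (fun v => by rw [hJ0]; rfl)
  obtain ⟨f, hf, hf0⟩ := exists_smooth_family (r := r) hΨ hq hΨ0 hq2 hcompat
  obtain ⟨ρ, hρ, hjet⟩ := Metric.eventually_nhds_iff_ball.1
    (eventually_exists_jet (hf.mono fun a h => h.1) hf0 hf.curry_nhds)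
  refine ⟨Metric.ball 0 ρ, Metric.isOpen_ball, Metric.mem_ball_self hρ, fun z₀ p hp a => ?_⟩
  obtain ⟨s, hs, hs0⟩ : ∃ s : ℝ, (p, fun k : Fin r => s ^ ((k : ℕ) + 1) • a k) ∈
      Metric.ball (0 : (Fin n → ℂ) × (Fin r → Fin n → ℂ)) ρ ∧ 0 < s := by
    have hc : Continuous fun s : ℝ => (p, fun k : Fin r => s ^ ((k : ℕ) + 1) • a k) := by fun_prop
    have h0 : (p, fun k : Fin r => (0 : ℝ) ^ ((k : ℕ) + 1) • a k) ∈
        Metric.ball (0 : (Fin n → ℂ) × (Fin r → Fin n → ℂ)) ρ := by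
      simp_rw [zero_pow (Nat.succ_ne_zero _), zero_smul]
      rw [mem_ball_zero_iff] at hp ⊢
      exact max_lt hp ((norm_zero (E := Fin r → Fin n → ℂ)).trans_lt hρ)
    have hev := hc.continuousAt.eventually (Metric.isOpen_ball.mem_nhds h0)
    exact ((hev.filter_mono nhdsWithin_le_nhds).and
      (self_mem_nhdsWithin : Ioi (0 : ℝ) ∈ 𝓝[>] 0)).exists
  obtain ⟨c, hc, hcp, hca⟩ := hjet _ hs
  set d : ℂ := 7 / 8 - s⁻¹ • z₀ with hd
  have hz₀ : s⁻¹ • z₀ + d = 7 / 8 := by rw [hd]; abel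
  have haff : Tendsto (fun z : ℂ => s⁻¹ • z + d) (𝓝 z₀) (𝓝 (7 / 8)) := by
    have h : Continuous fun z : ℂ => s⁻¹ • z + d := by fun_prop
    simpa only [hz₀] using h.tendsto z₀
  obtain ⟨ε, hε, hu⟩ := Metric.eventually_nhds_iff_ball.1 (haff.eventually hc)
  refine ⟨ε, fun z => f (c, s⁻¹ • z + d), hε, fun z hz => ?_, fun z hz => ?_, ?_, fun k => ?_⟩
  · refine (ContDiffAt.comp (g := f) (f := fun z : ℂ => (c, s⁻¹ • z + d)) z (hu z hz).1
      ?_).contDiffWithinAt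
    fun_prop
  · obtain ⟨ξ, hξ⟩ := (hu z hz).2
    have h := fderiv_comp_affine (fun y => f (c, y)) s⁻¹ d z
    simp only [pX, pY, h, smul_apply, hξ, map_smul, ← smul_add]
    rw [one_smul, hΨJ, smul_zero]
  · dsimp only
    rw [hz₀, hcp]
  · rw [iterate_pX_comp_affine (fun y => f (c, y))]
    simp only [hz₀, hca, smul_smul]
    rw [← mul_pow, inv_mul_cancel₀ hs0.ne', one_pow, one_smul]
end

section
/- Let J be an almost complex structure on ℝ^{2n}, let r ≥ 0, and let u, v be J-holomorphic maps defined on an open neighbourhood of 0 ∈ ℂ with u(0) = v(0). If ∂_x^ℓ u(0) = ∂_x^ℓ v(0) for every ℓ = 1, …, r, then all partial derivatives of u and v up to order r coincide at 0; that is, ∂_x^a ∂_y^b u(0) = ∂_x^a ∂_y^b v(0) whenever a + b ≤ r. -/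
open Filter Topology
open scoped ContDiff

universe u

section Jets

variable {E F G : Type*} [NormedAddCommGroup E] [NormedSpace ℝ E]
  [NormedAddCommGroup F] [NormedSpace ℝ F] [NormedAddCommGroup G] [NormedSpace ℝ G]

/-- The derivative of `f` in the constant direction `w`, as a function of the base point. -/
noncomputable def dirDeriv (w : ℂ) (f : ℂ → E) : ℂ → E := fun z => fderiv ℝ f z w

lemma dirDeriv_congr {f g : ℂ → E} {z : ℂ} (w : ℂ) (h : f =ᶠ[𝓝 z] g) :
    dirDeriv w f =ᶠ[𝓝 z] dirDeriv w g :=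
  h.fderiv.mono fun _ hz => congrArg (fun L : ℂ →L[ℝ] E => L w) hz

lemma dirDeriv_iterate_congr {f g : ℂ → E} {z : ℂ} (w : ℂ) (h : f =ᶠ[𝓝 z] g) (k : ℕ) :
    (dirDeriv w)^[k] f =ᶠ[𝓝 z] (dirDeriv w)^[k] g := by
  induction k generalizing f g with
  | zero => exact h
  | succ k ih => exact ih (dirDeriv_congr w h)

lemma ContDiffAt.dirDeriv {f : ℂ → E} {z : ℂ} (w : ℂ) (h : ContDiffAt ℝ ∞ f z) :
    ContDiffAt ℝ ∞ (dirDeriv w f) z :=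
  (h.fderiv_right (m := ∞) (by simp)).clm_apply contDiffAt_const

lemma ContDiffAt.eventually_differentiableAt {f : ℂ → E} {z : ℂ} (h : ContDiffAt ℝ ∞ f z) :
    ∀ᶠ y in 𝓝 z, DifferentiableAt ℝ f y :=
  ((h.of_le (m := 1) (by exact_mod_cast le_top)).eventually (by simp)).mono
    fun _ hy => hy.differentiableAt (by simp)

lemma dirDeriv_comm {f : ℂ → E} {z : ℂ} (h : ContDiffAt ℝ ∞ f z) (w₁ w₂ : ℂ) :
    dirDeriv w₁ (dirDeriv w₂ f) =ᶠ[𝓝 z] dirDeriv w₂ (dirDeriv w₁ f) := by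
  filter_upwards [(h.of_le (m := 2) (WithTop.coe_le_coe.2 (le_top : (2 : ℕ∞) ≤ ⊤))).eventually (by simp)] with y hy
  have hd : DifferentiableAt ℝ (fderiv ℝ f) y :=
    (hy.fderiv_right (m := 1) (by norm_num)).differentiableAt (by simp)
  have hsymm := (hy.isSymmSndFDerivAt (by simp)).eq w₁ w₂
  have happly (w w' : ℂ) :
      dirDeriv w (dirDeriv w' f) y = fderiv ℝ (fderiv ℝ f) y w w' := by
    change fderiv ℝ (fun x => fderiv ℝ f x w') y w = _
    simp [fderiv_clm_apply hd (differentiableAt_const w')]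
  rw [happly, happly, hsymm]

lemma dirDeriv_iterate_comm {f : ℂ → E} {z : ℂ} (h : ContDiffAt ℝ ∞ f z) (w₁ w₂ : ℂ) (k : ℕ) :
    (dirDeriv w₁)^[k] (dirDeriv w₂ f) =ᶠ[𝓝 z] dirDeriv w₂ ((dirDeriv w₁)^[k] f) := by
  induction k generalizing f with
  | zero => rfl
  | succ k ih =>
    exact (dirDeriv_iterate_congr w₁ (dirDeriv_comm h w₁ w₂) k).trans (ih (h.dirDeriv w₁))

lemma dirDeriv_add {f g : ℂ → E} {z : ℂ} (hf : ContDiffAt ℝ ∞ f z) (hg : ContDiffAt ℝ ∞ g z)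
    (w : ℂ) :
    dirDeriv w (fun y => f y + g y) =ᶠ[𝓝 z] fun y => dirDeriv w f y + dirDeriv w g y := by
  filter_upwards [hf.eventually_differentiableAt, hg.eventually_differentiableAt] with y h₁ h₂
  simp [dirDeriv, fderiv_fun_add h₁ h₂]

lemma dirDeriv_clm_apply {A : ℂ → F →L[ℝ] G} {f : ℂ → F} {z : ℂ}
    (hA : ContDiffAt ℝ ∞ A z) (hf : ContDiffAt ℝ ∞ f z) (w : ℂ) :
    dirDeriv w (fun y => A y (f y)) =ᶠ[𝓝 z]
      fun y => A y (dirDeriv w f y) + dirDeriv w A y (f y) := by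
  filter_upwards [hA.eventually_differentiableAt, hf.eventually_differentiableAt] with y h₁ h₂
  simp [dirDeriv, fderiv_clm_apply h₁ h₂]

lemma dirDeriv_comp {Φ : F → G} (hΦ : ContDiff ℝ ∞ Φ) {f : ℂ → F} {z : ℂ}
    (hf : ContDiffAt ℝ ∞ f z) (w : ℂ) :
    dirDeriv w (fun y => Φ (f y)) =ᶠ[𝓝 z] fun y => fderiv ℝ Φ (f y) (dirDeriv w f y) := by
  filter_upwards [hf.eventually_differentiableAt] with y hy
  have hd := fderiv_comp y (hΦ.differentiable (by simp) (f y)) hy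
  exact congrArg (fun L : ℂ →L[ℝ] G => L w) hd

/-- `f` and `g` have the same mixed partial derivatives at `0` of total order at most `m` and of
order at most `b` in the `y`-direction. -/
def JetAgree (m b : ℕ) (f g : ℂ → E) : Prop :=
  ∀ a c : ℕ, c ≤ b → a + c ≤ m →
    (dirDeriv 1)^[a] ((dirDeriv Complex.I)^[c] f) 0 =
      (dirDeriv 1)^[a] ((dirDeriv Complex.I)^[c] g) 0

namespace JetAgree

variable {m b : ℕ} {f g : ℂ → E}

lemma mono {m' b' : ℕ} (h : JetAgree m b f g) (hm : m' ≤ m) (hb : b' ≤ b) :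
    JetAgree m' b' f g :=
  fun a c hc hac => h a c (hc.trans hb) (hac.trans hm)

lemma apply_zero (h : JetAgree m b f g) : f 0 = g 0 := h 0 0 b.zero_le m.zero_le

lemma congr {f' g' : ℂ → E} (h : JetAgree m b f g) (hf : f' =ᶠ[𝓝 0] f) (hg : g' =ᶠ[𝓝 0] g) :
    JetAgree m b f' g' := fun a c hc hac => by
  rw [(dirDeriv_iterate_congr 1 (dirDeriv_iterate_congr Complex.I hf c) a).self_of_nhds,
    (dirDeriv_iterate_congr 1 (dirDeriv_iterate_congr Complex.I hg c) a).self_of_nhds]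
  exact h a c hc hac

lemma dirDeriv_one (h : JetAgree (m + 1) b f g) (hf : ContDiffAt ℝ ∞ f 0)
    (hg : ContDiffAt ℝ ∞ g 0) : JetAgree m b (dirDeriv 1 f) (dirDeriv 1 g) :=
  fun a c hc hac => by
    rw [(dirDeriv_iterate_congr 1 (dirDeriv_iterate_comm hf Complex.I 1 c) a).self_of_nhds,
      (dirDeriv_iterate_congr 1 (dirDeriv_iterate_comm hg Complex.I 1 c) a).self_of_nhds]
    exact h (a + 1) c hc (by omega)

lemma dirDeriv_I (h : JetAgree (m + 1) (b + 1) f g) :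
    JetAgree m b (dirDeriv Complex.I f) (dirDeriv Complex.I g) :=
  fun a c hc hac => h a (c + 1) (by omega) (by omega)

lemma of_apply_zero (h₀ : f 0 = g 0) : JetAgree 0 b f g := fun a c _ hac => by
  obtain ⟨rfl, rfl⟩ : a = 0 ∧ c = 0 := by omega
  exact h₀

lemma of_dirDeriv (h₀ : f 0 = g 0) (h₁ : JetAgree m b (dirDeriv 1 f) (dirDeriv 1 g))
    (h₂ : ∀ b', b = b' + 1 → JetAgree m b' (dirDeriv Complex.I f) (dirDeriv Complex.I g)) :
    JetAgree (m + 1) b f g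
  | 0, 0, _, _ => h₀
  | a + 1, 0, hc, hac => h₁ a 0 hc (by omega)
  | a, c + 1, hc, hac => h₂ (b - 1) (by omega) a c (by omega) (by omega)

lemma add {f' g' : ℂ → E} (h : JetAgree m b f g) (h' : JetAgree m b f' g')
    (hf : ContDiffAt ℝ ∞ f 0) (hg : ContDiffAt ℝ ∞ g 0)
    (hf' : ContDiffAt ℝ ∞ f' 0) (hg' : ContDiffAt ℝ ∞ g' 0) :
    JetAgree m b (fun z => f z + f' z) (fun z => g z + g' z) := by
  have h₀ : f 0 + f' 0 = g 0 + g' 0 := by rw [h.apply_zero, h'.apply_zero]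
  induction m generalizing b f g f' g' with
  | zero => exact of_apply_zero h₀
  | succ m ih =>
    have key (b' : ℕ) (w : ℂ) (H : JetAgree m b' (dirDeriv w f) (dirDeriv w g))
        (H' : JetAgree m b' (dirDeriv w f') (dirDeriv w g')) :
        JetAgree m b' (dirDeriv w fun z => f z + f' z) (dirDeriv w fun z => g z + g' z) :=
      (ih H H' (hf.dirDeriv w) (hg.dirDeriv w) (hf'.dirDeriv w) (hg'.dirDeriv w)
        (by rw [H.apply_zero, H'.apply_zero])).congr (dirDeriv_add hf hf' w) (dirDeriv_add hg hg' w)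
    refine of_dirDeriv h₀ (key b 1 (h.dirDeriv_one hf hg) (h'.dirDeriv_one hf' hg')) ?_
    rintro b' rfl
    exact key b' Complex.I h.dirDeriv_I h'.dirDeriv_I

lemma clm_apply {A B : ℂ → F →L[ℝ] G} {f g : ℂ → F} (h : JetAgree m b A B)
    (h' : JetAgree m b f g) (hA : ContDiffAt ℝ ∞ A 0) (hB : ContDiffAt ℝ ∞ B 0)
    (hf : ContDiffAt ℝ ∞ f 0) (hg : ContDiffAt ℝ ∞ g 0) :
    JetAgree m b (fun z => A z (f z)) (fun z => B z (g z)) := by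
  have h₀ : A 0 (f 0) = B 0 (g 0) := by rw [h.apply_zero, h'.apply_zero]
  induction m generalizing b A B f g with
  | zero => exact of_apply_zero h₀
  | succ m ih =>
    have key (b' : ℕ) (hb : b' ≤ b) (w : ℂ) (H : JetAgree m b' (dirDeriv w A) (dirDeriv w B))
        (H' : JetAgree m b' (dirDeriv w f) (dirDeriv w g)) :
        JetAgree m b' (dirDeriv w fun z => A z (f z)) (dirDeriv w fun z => B z (g z)) :=
      (add
        (ih (h.mono m.le_succ hb) H' hA hB (hf.dirDeriv w) (hg.dirDeriv w)
          (by rw [h.apply_zero, H'.apply_zero]))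
        (ih H (h'.mono m.le_succ hb) (hA.dirDeriv w) (hB.dirDeriv w) hf hg
          (by rw [H.apply_zero, h'.apply_zero]))
        (hA.clm_apply (hf.dirDeriv w)) (hB.clm_apply (hg.dirDeriv w))
        ((hA.dirDeriv w).clm_apply hf) ((hB.dirDeriv w).clm_apply hg)).congr
        (dirDeriv_clm_apply hA hf w) (dirDeriv_clm_apply hB hg w)
    refine of_dirDeriv h₀ (key b le_rfl 1 (h.dirDeriv_one hA hB) (h'.dirDeriv_one hf hg)) ?_
    rintro b' rfl
    exact key b' b'.le_succ Complex.I h.dirDeriv_I h'.dirDeriv_I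

lemma comp {F G : Type u} [NormedAddCommGroup F] [NormedSpace ℝ F] [NormedAddCommGroup G]
    [NormedSpace ℝ G] {Φ : F → G} (hΦ : ContDiff ℝ ∞ Φ) {f g : ℂ → F} (h : JetAgree m b f g)
    (hf : ContDiffAt ℝ ∞ f 0) (hg : ContDiffAt ℝ ∞ g 0) :
    JetAgree m b (fun z => Φ (f z)) (fun z => Φ (g z)) := by
  have h₀ : Φ (f 0) = Φ (g 0) := by rw [h.apply_zero]
  induction m generalizing b G with
  | zero => exact of_apply_zero h₀
  | succ m ih =>
    have hΦ' : ContDiff ℝ ∞ (fderiv ℝ Φ) := hΦ.fderiv_right (by simp)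
    have key (b' : ℕ) (hb : b' ≤ b) (w : ℂ)
        (H : JetAgree m b' (dirDeriv w f) (dirDeriv w g)) :
        JetAgree m b' (dirDeriv w fun z => Φ (f z)) (dirDeriv w fun z => Φ (g z)) :=
      (clm_apply (ih hΦ' (h.mono m.le_succ hb) (by rw [h.apply_zero])) H
        (hΦ'.contDiffAt.comp 0 hf) (hΦ'.contDiffAt.comp 0 hg)
        (hf.dirDeriv w) (hg.dirDeriv w)).congr
        (dirDeriv_comp hΦ hf w) (dirDeriv_comp hΦ hg w)
    refine of_dirDeriv h₀ (key b le_rfl 1 (h.dirDeriv_one hf hg)) ?_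
    rintro b' rfl
    exact key b' b'.le_succ Complex.I h.dirDeriv_I

end JetAgree

end Jets

lemma dirDeriv_I_eq_of_holomorphic {E : Type*} [NormedAddCommGroup E] [NormedSpace ℝ E]
    {J : E → E →L[ℝ] E} (hJ : ∀ p, (J p).comp (J p) = - ContinuousLinearMap.id ℝ E)
    {u : ℂ → E} {z : ℂ} (h : pX u z + J (u z) (pY u z) = 0) :
    dirDeriv Complex.I u z = J (u z) (dirDeriv 1 u z) := by
  have hsq : J (u z) (J (u z) (pY u z)) = -pY u z :=
    congrArg (fun L : E →L[ℝ] E => L (pY u z)) (hJ (u z))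
  change pY u z = J (u z) (pX u z)
  rw [eq_neg_of_add_eq_zero_left h, map_neg, hsq, neg_neg]

/-- two `J`-holomorphic maps near `0 ∈ ℂ` with the same value at `0` and the
same derivatives `∂ₓ^ℓ` at `0` up to order `r` have all partial derivatives up to order
`r` equal at `0`. -/
theorem stmt2 (n r : ℕ)
    (J : (Fin n → ℂ) → ((Fin n → ℂ) →L[ℝ] (Fin n → ℂ)))
    (hJsmooth : ContDiff ℝ (⊤ : ℕ∞) J)
    (hJsq : ∀ p, (J p).comp (J p) = - ContinuousLinearMap.id ℝ (Fin n → ℂ))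
    (U : Set ℂ) (hU : IsOpen U) (h0 : (0 : ℂ) ∈ U)
    (u v : ℂ → (Fin n → ℂ))
    (hu : ContDiffOn ℝ (⊤ : ℕ∞) u U) (hv : ContDiffOn ℝ (⊤ : ℕ∞) v U)
    (huhol : ∀ z ∈ U, pX u z + J (u z) (pY u z) = 0)
    (hvhol : ∀ z ∈ U, pX v z + J (v z) (pY v z) = 0)
    (h00 : u 0 = v 0)
    (hx : ∀ ℓ : ℕ, 1 ≤ ℓ → ℓ ≤ r → (pX^[ℓ] u) 0 = (pX^[ℓ] v) 0) :
    ∀ a b : ℕ, a + b ≤ r → (pX^[a] (pY^[b] u)) 0 = (pX^[a] (pY^[b] v)) 0 := by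
  have hU₀ : U ∈ 𝓝 (0 : ℂ) := hU.mem_nhds h0
  have hu₀ : ContDiffAt ℝ ∞ u 0 := hu.contDiffAt hU₀
  have hv₀ : ContDiffAt ℝ ∞ v 0 := hv.contDiffAt hU₀
  have agree (b : ℕ) : JetAgree r b u v := by
    induction b with
    | zero =>
      intro a c hc hac
      obtain rfl : c = 0 := by omega
      rcases Nat.eq_zero_or_pos a with rfl | ha
      · exact h00
      · exact hx a ha hac
    | succ b ih =>
      cases r with
      | zero => exact .of_apply_zero h00
      | succ r =>
        intro a c hc hac
        rcases hc.lt_or_eq with hc | rfl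
        · exact ih a c (by omega) hac
        have hJ := (ih.mono r.le_succ le_rfl).comp hJsmooth hu₀ hv₀
        have hy := (hJ.clm_apply (ih.dirDeriv_one hu₀ hv₀) (hJsmooth.contDiffAt.comp 0 hu₀)
          (hJsmooth.contDiffAt.comp 0 hv₀) (hu₀.dirDeriv 1) (hv₀.dirDeriv 1)).congr
          (eventually_of_mem hU₀ fun z hz => dirDeriv_I_eq_of_holomorphic hJsq (huhol z hz))
          (eventually_of_mem hU₀ fun z hz => dirDeriv_I_eq_of_holomorphic hJsq (hvhol z hz))
        exact hy a b le_rfl (by omega)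
  exact fun a b hab => agree b a b le_rfl hab
end

section
/- Let s ≥ 0 be an integer and let u be a continuous map from the closed unit disc in ℂ to ℂ which is holomorphic on the open unit disc and satisfies the boundary condition w^{−s} u(w²) ∈ ℝ for every w ∈ ℂ with |w| = 1 (equivalently: u(e^{2πiθ}) ∈ e^{sπiθ}ℝ for all θ ∈ ℝ). Then there exist unique real numbers c₀, …, c_s such that u(z) = Σ_{ℓ=0}^{s} c_ℓ q_ℓ(z) for all z in the closed unit disc. In particular, u is a polynomial of degree at most s, and the real vector space of all such functions u has dimension s + 1. -/
/-- The polynomial `q_ℓ(z) = i^ℓ (1+z)^{s-ℓ} (1-z)^ℓ`. -/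
noncomputable def q (s ℓ : ℕ) (z : ℂ) : ℂ :=
  Complex.I ^ ℓ * (1 + z) ^ (s - ℓ) * (1 - z) ^ ℓ

theorem coeff_eq_zero_of_sum_cos_sin_eq_zero {s : ℕ} {d : Fin (s + 1) → ℝ}
    (h : ∀ x : ℝ, ∑ ℓ : Fin (s + 1),
      d ℓ * (Real.cos x ^ (s - ℓ : ℕ) * Real.sin x ^ (ℓ : ℕ)) = 0) : d = 0 := by
  set p : Polynomial ℝ := ∑ ℓ : Fin (s + 1), Polynomial.monomial ℓ (d ℓ) with hp
  have hp0 : p = 0 := by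
    refine Polynomial.funext fun t => ?_
    have hc : Real.cos (Real.arctan t) ≠ 0 := (Real.cos_arctan_pos t).ne'
    have hs : Real.sin (Real.arctan t) = t * Real.cos (Real.arctan t) := by
      rw [← Real.tan_mul_cos hc, Real.tan_arctan]
    have ht := h (Real.arctan t)
    have hfac : ∑ ℓ : Fin (s + 1), d ℓ *
        (Real.cos (Real.arctan t) ^ (s - ℓ : ℕ) * Real.sin (Real.arctan t) ^ (ℓ : ℕ))
        = Real.cos (Real.arctan t) ^ s * p.eval t := by
      rw [hp, Polynomial.eval_finsetSum, Finset.mul_sum]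
      refine Finset.sum_congr rfl fun ℓ _ => ?_
      rw [Polynomial.eval_monomial, hs, mul_pow, ← pow_sub_mul_pow _ (Nat.lt_succ_iff.mp ℓ.2)]
      ring
    rw [hfac] at ht
    simpa [hc] using ht
  funext ℓ
  have := congrArg (fun r => Polynomial.coeff r ℓ) hp0
  simpa [hp, Polynomial.finsetSum_coeff, Polynomial.coeff_monomial, Fin.val_inj] using this

theorem q_exp (s ℓ : ℕ) (hℓ : ℓ ≤ s) (x : ℝ) :
    q s ℓ (Complex.exp (2 * x * Complex.I)) = Complex.exp (s * x * Complex.I) *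
      ((2 ^ s * (Real.cos x ^ (s - ℓ) * Real.sin x ^ ℓ) : ℝ) : ℂ) := by
  have hI := Complex.I_sq
  have hsq : Complex.exp (2 * x * Complex.I) = Complex.exp (x * Complex.I) ^ 2 := by
    rw [← Complex.exp_nat_mul]; congr 1; push_cast; ring
  have hs : Complex.exp (s * x * Complex.I) = Complex.exp (x * Complex.I) ^ s := by
    rw [← Complex.exp_nat_mul]; congr 1; ring
  have hcs : Complex.cos x ^ 2 + Complex.sin x ^ 2 = 1 := by
    rw [add_comm]; exact Complex.sin_sq_add_cos_sq x
  have hp : 1 + Complex.exp (x * Complex.I) ^ 2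
      = Complex.exp (x * Complex.I) * (2 * Complex.cos x) := by
    rw [Complex.exp_mul_I]
    linear_combination -hcs + Complex.sin x ^ 2 * hI
  have hm : Complex.I * (1 - Complex.exp (x * Complex.I) ^ 2)
      = Complex.exp (x * Complex.I) * (2 * Complex.sin x) := by
    rw [Complex.exp_mul_I]
    linear_combination -Complex.I * hcs
      + (-2 * Complex.cos x * Complex.sin x - Complex.I * Complex.sin x ^ 2) * hI
  have : q s ℓ (Complex.exp (x * Complex.I) ^ 2)
      = (1 + Complex.exp (x * Complex.I) ^ 2) ^ (s - ℓ)
        * (Complex.I * (1 - Complex.exp (x * Complex.I) ^ 2)) ^ ℓ := by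
    rw [q, mul_pow]; ring
  rw [hsq, this, hp, hm, hs]
  obtain ⟨k, rfl⟩ := Nat.exists_eq_add_of_le' hℓ
  push_cast
  rw [Nat.add_sub_cancel]
  ring

/-- If a complex combination of the `q_ℓ` satisfies the boundary condition, then its coefficients
are real. -/
theorem im_eq_zero_of_sum_q_boundary {s : ℕ} {c : Fin (s + 1) → ℂ}
    (h : ∀ x : ℝ, ∃ r : ℝ, ∑ ℓ : Fin (s + 1), c ℓ * q s ℓ (Complex.exp (2 * x * Complex.I))
      = Complex.exp (s * x * Complex.I) * r) (ℓ : Fin (s + 1)) : (c ℓ).im = 0 := by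
  refine congrFun (coeff_eq_zero_of_sum_cos_sin_eq_zero (d := fun ℓ => (c ℓ).im) fun x => ?_) ℓ
  obtain ⟨r, hr⟩ := h x
  have key : ∑ ℓ : Fin (s + 1), c ℓ *
      ((2 ^ s * (Real.cos x ^ (s - ℓ : ℕ) * Real.sin x ^ (ℓ : ℕ)) : ℝ) : ℂ) = r := by
    refine mul_left_cancel₀ (Complex.exp_ne_zero (s * x * Complex.I)) ?_
    rw [← hr, Finset.mul_sum]
    refine Finset.sum_congr rfl fun ℓ _ => ?_
    rw [q_exp s ℓ (Nat.lt_succ_iff.mp ℓ.2)]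
    ring
  have him := congrArg Complex.im key
  simp only [Complex.im_sum, Complex.im_mul_ofReal, Complex.ofReal_im] at him
  refine (mul_eq_zero.mp (?_ : (2 : ℝ) ^ s * _ = 0)).resolve_left (by positivity)
  rw [← him, Finset.mul_sum]
  exact Finset.sum_congr rfl fun ℓ _ => by ring

theorem exists_eval_eq_sum_q (s : ℕ) (p : Polynomial ℂ) (hp : p.natDegree ≤ s) :
    ∃ c : ℕ → ℂ, ∀ z, p.eval z = ∑ ℓ ∈ Finset.range (s + 1), c ℓ * q s ℓ z := by
  induction s generalizing p with
  | zero =>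
    rw [Polynomial.eq_C_of_natDegree_le_zero hp]
    exact ⟨fun _ => p.coeff 0, fun z => by simp [q]⟩
  | succ s ih =>
    obtain ⟨a, ha⟩ : ∃ a : ℂ, a * q (s + 1) (s + 1) (-1) = p.eval (-1) :=
      ⟨p.eval (-1) / q (s + 1) (s + 1) (-1), div_mul_cancel₀ _ (by norm_num [q])⟩
    set top : Polynomial ℂ :=
      Polynomial.C (a * Complex.I ^ (s + 1)) * (1 - Polynomial.X) ^ (s + 1) with htop
    have htop_eval (z : ℂ) : top.eval z = a * q (s + 1) (s + 1) z := by
      simp [htop, q, mul_assoc]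
    have hdeg : (p - top).natDegree ≤ s + 1 := by
      refine (Polynomial.natDegree_sub_le_of_le hp (n := s + 1) ?_).trans (by simp)
      rw [htop]; compute_degree
    obtain ⟨r, hr⟩ : (Polynomial.X - Polynomial.C (-1)) ∣ p - top := by
      rw [Polynomial.dvd_iff_isRoot, Polynomial.IsRoot, Polynomial.eval_sub, htop_eval, ha,
        sub_self]
    have hrdeg : r.natDegree ≤ s := by
      rcases eq_or_ne r 0 with rfl | hr0
      · simp
      rw [hr, Polynomial.natDegree_mul (Polynomial.X_sub_C_ne_zero _) hr0,
        Polynomial.natDegree_X_sub_C] at hdeg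
      omega
    obtain ⟨c, hc⟩ := ih r hrdeg
    refine ⟨fun ℓ => if ℓ = s + 1 then a else c ℓ, fun z => ?_⟩
    have hz := congrArg (Polynomial.eval z) hr
    rw [Polynomial.eval_sub, htop_eval, Polynomial.eval_mul, hc, Finset.mul_sum] at hz
    simp only [Finset.sum_range_succ _ (s + 1), if_true]
    rw [eq_add_of_sub_eq hz]
    congr 1
    refine Finset.sum_congr rfl fun ℓ hℓ => ?_
    have hℓ' := Finset.mem_range.mp hℓ
    rw [if_neg hℓ'.ne, q, q, Nat.succ_sub (by omega), pow_succ]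
    simp only [Polynomial.eval_sub, Polynomial.eval_X, Polynomial.eval_C]
    ring

/-- Under the boundary condition `u = e^{isθ} conj u` on the unit circle, the Taylor coefficients
of `u` of order greater than `s` vanish. -/
theorem cauchyPowerSeries_eq_zero_of_boundary {s : ℕ} {u : ℂ → ℂ}
    (hu : DiffContOnCl ℂ u (Metric.ball (0 : ℂ) 1))
    (hbdry : ∀ x : ℝ, (starRingEnd ℂ) (u (Complex.exp (x * Complex.I)))
      = Complex.exp (-(s * x * Complex.I)) * u (Complex.exp (x * Complex.I)))
    {n : ℕ} (hn : s < n) (w : ℂ) : (cauchyPowerSeries u 0 1 n fun _ => w) = 0 := by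
  obtain ⟨k, rfl⟩ := Nat.exists_eq_add_of_lt hn
  have hzero : (∮ z in C(0, 1), z ^ k * u z) = 0 :=
    DiffContOnCl.circleIntegral_eq_zero zero_le_one
      ((differentiable_id.pow k).diffContOnCl.smul hu)
  have hconj : ∫ x : ℝ in 0..2 * Real.pi, Complex.exp (-((s + k + 1 : ℕ) * x * Complex.I))
      * u (Complex.exp (x * Complex.I)) = 0 := by
    rw [← map_eq_zero (starRingEnd ℂ), ← intervalIntegral.intervalIntegral_conj]
    have : ∀ x : ℝ, (starRingEnd ℂ) (Complex.exp (-((s + k + 1 : ℕ) * x * Complex.I))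
        * u (Complex.exp (x * Complex.I)))
        = -Complex.I * (deriv (circleMap 0 1) x • (circleMap 0 1 x ^ k * u (circleMap 0 1 x))) := by
      intro x
      rw [map_mul, hbdry, ← Complex.exp_conj, deriv_circleMap]
      simp only [circleMap, zero_add, Complex.ofReal_one, one_mul, smul_eq_mul, map_neg, map_mul,
        Complex.conj_ofReal, Complex.conj_I, map_natCast]
      rw [← mul_assoc, ← Complex.exp_add, ← Complex.exp_nat_mul]
      have : Complex.exp (-(((s + k + 1 : ℕ) : ℂ) * x * -Complex.I) + -(s * x * Complex.I))
          = Complex.exp (x * Complex.I) * Complex.exp (k * (x * Complex.I)) := by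
        rw [← Complex.exp_add]; congr 1; push_cast; ring
      rw [this]
      linear_combination (Complex.exp (x * Complex.I) * Complex.exp (k * (x * Complex.I))
        * u (Complex.exp (x * Complex.I))) * Complex.I_sq
    simp_rw [this]
    rw [intervalIntegral.integral_const_mul]
    rw [circleIntegral] at hzero
    rw [hzero, mul_zero]
  rw [cauchyPowerSeries_apply, circleIntegral]
  have : ∀ x : ℝ, deriv (circleMap 0 1) x •
      ((w / (circleMap 0 1 x - 0)) ^ (s + k + 1) • (circleMap 0 1 x - 0)⁻¹ • u (circleMap 0 1 x))
      = Complex.I * w ^ (s + k + 1) * (Complex.exp (-((s + k + 1 : ℕ) * x * Complex.I))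
      * u (Complex.exp (x * Complex.I))) := by
    intro x
    rw [deriv_circleMap, Complex.exp_neg, mul_assoc ((s + k + 1 : ℕ) : ℂ), Complex.exp_nat_mul]
    simp only [circleMap, zero_add, Complex.ofReal_one, one_mul, smul_eq_mul, sub_zero, div_pow]
    field_simp
  simp_rw [this]
  rw [intervalIntegral.integral_const_mul, hconj, mul_zero, smul_zero]

/-- A function satisfying the boundary condition agrees with a polynomial of degree at most `s` on
the closed unit disc. -/
theorem exists_polynomial_of_boundary {s : ℕ} {u : ℂ → ℂ}
    (hcont : ContinuousOn u (Metric.closedBall (0 : ℂ) 1))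
    (hhol : DifferentiableOn ℂ u (Metric.ball (0 : ℂ) 1))
    (hbdry : ∀ x : ℝ, (starRingEnd ℂ) (u (Complex.exp (x * Complex.I)))
      = Complex.exp (-(s * x * Complex.I)) * u (Complex.exp (x * Complex.I))) :
    ∃ p : Polynomial ℂ, p.natDegree ≤ s ∧ Set.EqOn u p.eval (Metric.closedBall (0 : ℂ) 1) := by
  have hcl : closure (Metric.ball (0 : ℂ) 1) = Metric.closedBall 0 1 :=
    closure_ball _ one_ne_zero
  have hu : DiffContOnCl ℂ u (Metric.ball (0 : ℂ) 1) := ⟨hhol, hcl ▸ hcont⟩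
  have hps := hu.hasFPowerSeriesOnBall (R := 1) one_pos
  refine ⟨∑ n ∈ Finset.range (s + 1), Polynomial.monomial n ((cauchyPowerSeries u 0 1).coeff n),
    Polynomial.natDegree_sum_le_of_forall_le _ _ fun n hn =>
      (Polynomial.natDegree_monomial_le _).trans (Nat.lt_succ_iff.mp (Finset.mem_range.mp hn)),
    Set.EqOn.of_subset_closure (s := Metric.ball 0 1) (fun z hz => ?_) hcont
      (Polynomial.continuous _).continuousOn Metric.ball_subset_closedBall hcl.ge⟩
  have hsum := hps.hasSum (y := z) (by
    rw [← NNReal.coe_one, ← Metric.eball_coe] at hz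
    exact hz)
  rw [zero_add] at hsum
  rw [hsum.unique (hasSum_sum_of_ne_finset_zero (s := Finset.range (s + 1)) fun n hn =>
    cauchyPowerSeries_eq_zero_of_boundary hu hbdry (by simpa using hn) z),
    Polynomial.eval_finsetSum]
  refine Finset.sum_congr rfl fun n _ => ?_
  rw [Polynomial.eval_monomial, FormalMultilinearSeries.apply_eq_pow_smul_coeff, smul_eq_mul,
    mul_comm]
  rfl

/-- a continuous function on the closed unit disc, holomorphic in the
interior, with boundary values `u(e^{2πiθ}) ∈ e^{sπiθ} ℝ`, is a unique real linear
combination of the polynomials `q_0, …, q_s`. -/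
theorem stmt8 (s : ℕ) (u : ℂ → ℂ)
    (hcont : ContinuousOn u (Metric.closedBall (0 : ℂ) 1))
    (hhol : DifferentiableOn ℂ u (Metric.ball (0 : ℂ) 1))
    (hbdry : ∀ θ : ℝ, ∃ c : ℝ,
      u (Complex.exp (2 * Real.pi * θ * Complex.I))
        = Complex.exp ((s * Real.pi * θ) * Complex.I) * (c : ℂ)) :
    ∃! c : Fin (s + 1) → ℝ,
      ∀ z ∈ Metric.closedBall (0 : ℂ) 1, u z = ∑ ℓ : Fin (s + 1), (c ℓ : ℂ) * q s ℓ z := by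
  have hb (x : ℝ) : ∃ r : ℝ,
      u (Complex.exp (2 * x * Complex.I)) = Complex.exp (s * x * Complex.I) * r := by
    obtain ⟨r, hr⟩ := hbdry (x / Real.pi)
    refine ⟨r, ?_⟩
    have hpi : (Real.pi : ℂ) ≠ 0 := by exact_mod_cast Real.pi_ne_zero
    rw [Complex.ofReal_div, mul_assoc (2 : ℂ), mul_assoc (s : ℂ), mul_div_cancel₀ _ hpi] at hr
    exact hr
  have hconj (x : ℝ) : (starRingEnd ℂ) (u (Complex.exp (x * Complex.I)))
      = Complex.exp (-(s * x * Complex.I)) * u (Complex.exp (x * Complex.I)) := by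
    obtain ⟨r, hr⟩ := hb (x / 2)
    have hx : (2 : ℂ) * ((x / 2 : ℝ) : ℂ) = x := by push_cast; ring
    rw [hx] at hr
    rw [hr, map_mul, Complex.conj_ofReal, ← Complex.exp_conj, ← mul_assoc, ← Complex.exp_add]
    simp only [map_mul, Complex.conj_ofReal, Complex.conj_I, map_natCast]
    congr 2
    push_cast
    ring
  have hmem (x : ℝ) : Complex.exp (2 * x * Complex.I) ∈ Metric.closedBall (0 : ℂ) 1 := by
    have := Complex.norm_exp_ofReal_mul_I (2 * x)
    push_cast at this
    simp [this]
  obtain ⟨p, hp, hup⟩ := exists_polynomial_of_boundary hcont hhol hconj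
  obtain ⟨c, hc⟩ := exists_eval_eq_sum_q s p hp
  have huc : ∀ z ∈ Metric.closedBall (0 : ℂ) 1, u z = ∑ ℓ : Fin (s + 1), c ℓ * q s ℓ z :=
    fun z hz => (hup hz).trans ((hc z).trans (Finset.sum_range _))
  have hreal (ℓ : Fin (s + 1)) : (((c ℓ).re : ℝ) : ℂ) = c ℓ := by
    refine Complex.ext rfl ?_
    rw [Complex.ofReal_im]
    refine (im_eq_zero_of_sum_q_boundary (c := fun ℓ : Fin (s + 1) => c ℓ) (fun x => ?_) ℓ).symm
    rw [← huc _ (hmem x)]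
    exact hb x
  refine ⟨fun ℓ => (c ℓ).re, fun z hz => ?_, fun c' hc' => funext fun ℓ => ?_⟩
  · simp only [hreal]
    exact huc z hz
  · have him := im_eq_zero_of_sum_q_boundary
      (c := fun ℓ : Fin (s + 1) => Complex.I * (c' ℓ - c ℓ)) (fun x => ⟨0, ?_⟩) ℓ
    · simpa [sub_eq_zero] using him
    · simp only [mul_assoc, sub_mul, ← Finset.mul_sum, Finset.sum_sub_distrib]
      simp only [← mul_assoc]
      rw [← huc _ (hmem x), ← hc' _ (hmem x)]
      simp
end
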